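/- arXiv:0911.4321 — 2 statements merged into one kernel-verified Lean document; each statement's English description precedes it below -/
import Mathlib

section
/- Let n ≥ 3, p > 1, q = (2p+n)/n, C_0 > 0. There exist ε > 0 and C > 0 depending only on n, p, the Sobolev constant C_s, and C_0 such that: if r > 0 and u is a nonnegative locally Lipschitz function on B_r with u ∈ L^p(B_r), satisfying Δu + C_0 u^q ≥ 0 weakly in B_r and ∫_{B_r} u^p dx < ε, then the reverse Hölder inequality (∫_{B_{r/2}} u^{p·n/(n-2)} dx)^{(n-2)/n} ≤ (C/r²) ∫_{B_r} u^p dx holds. -/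
open MeasureTheory Metric Finset Filter Asymptotics
open scoped RealInnerProductSpace

noncomputable section

/-- `pder u i x` is the partial derivative `Dᵢ u (x)` in the `i`-th coordinate direction. -/
def pder {n : ℕ} (u : EuclideanSpace ℝ (Fin n) → ℝ) (i : Fin n)
    (x : EuclideanSpace ℝ (Fin n)) : ℝ :=
  fderiv ℝ u x (EuclideanSpace.single i 1)

/-- The Euclidean Laplacian `Δu = ∑ i, D_i D_i u`. -/
def lap {n : ℕ} (u : EuclideanSpace ℝ (Fin n) → ℝ)
    (x : EuclideanSpace ℝ (Fin n)) : ℝ :=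
  ∑ i : Fin n, pder (pder u i) i x

/-- `|∇V|² = ∑_{l,j} (D_l V_j)²` for a vector-valued map `V`. -/
def gradNormSq {n m : ℕ}
    (V : EuclideanSpace ℝ (Fin n) → EuclideanSpace ℝ (Fin m))
    (x : EuclideanSpace ℝ (Fin n)) : ℝ :=
  ∑ l : Fin n, ∑ j : Fin m, (pder (fun y => V y j) l x) ^ 2

/-- `Δu + F ≥ 0` weakly on `Ω`: for every nonnegative smooth compactly supported
test function `φ` in `Ω`, `∫_Ω (-⟨∇u, ∇φ⟩ + F φ) ≥ 0`. -/
def IsWeakSupersol {n : ℕ} (Ω : Set (EuclideanSpace ℝ (Fin n)))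
    (u F : EuclideanSpace ℝ (Fin n) → ℝ) : Prop :=
  ∀ φ : EuclideanSpace ℝ (Fin n) → ℝ, ContDiff ℝ (⊤ : ℕ∞) φ → HasCompactSupport φ →
    tsupport φ ⊆ interior Ω → (∀ x, 0 ≤ φ x) →
    0 ≤ ∫ x in Ω, (-⟪gradient u x, gradient φ x⟫ + F x * φ x)

/-- `Cs` is a constant for the Sobolev inequality
`(∫ |w|^{2n/(n-2)})^{(n-2)/n} ≤ Cs ∫ |∇w|²` for compactly supported Lipschitz `w` on `ℝⁿ`. -/
def SobolevIneq (n : ℕ) (Cs : ℝ) : Prop :=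
  ∀ w : EuclideanSpace ℝ (Fin n) → ℝ, (∃ K, LipschitzWith K w) → HasCompactSupport w →
    (∫ x, |w x| ^ ((2 * (n : ℝ)) / ((n : ℝ) - 2))) ^ (((n : ℝ) - 2) / (n : ℝ))
      ≤ Cs * ∫ x, ‖gradient w x‖ ^ 2

section Mollification

variable {E : Type*} [NormedAddCommGroup E] [InnerProductSpace ℝ E] [FiniteDimensional ℝ E]

lemma LipschitzWith.norm_gradient_le {f : E → ℝ} {K : NNReal} (hf : LipschitzWith K f) (x : E) :
    ‖gradient f x‖ ≤ K := by
  rw [gradient, LinearIsometryEquiv.norm_map]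
  exact norm_fderiv_le_of_lipschitz ℝ hf

lemma inner_gradient_eq_fderiv (f : E → ℝ) (x v : E) : ⟪v, gradient f x⟫ = fderiv ℝ f x v := by
  rw [real_inner_comm, gradient, InnerProductSpace.toDual_symm_apply]

variable [MeasurableSpace E] [BorelSpace E]

lemma measurable_gradient_real (f : E → ℝ) : Measurable (gradient f) :=
  (InnerProductSpace.toDual ℝ E).symm.continuous.measurable.comp (measurable_fderiv ℝ f)

lemma hasFDerivAt_convolution_of_lipschitz {ρ φ : E → ℝ} {K : NNReal} (hρ : Continuous ρ)
    (hρc : HasCompactSupport ρ) (hφ : LipschitzWith K φ) (x : E) :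
    HasFDerivAt (convolution ρ φ (ContinuousLinearMap.lsmul ℝ ℝ) volume)
      (convolution ρ (fderiv ℝ φ) (ContinuousLinearMap.lsmul ℝ ℝ) volume x) x := by
  have hρi : Integrable ρ := hρ.integrable_of_hasCompactSupport hρc
  refine (hasFDerivAt_integral_of_dominated_loc_of_lip'
    (F := fun z t => ρ t • φ (z - t)) (F' := fun t => ρ t • fderiv ℝ φ (x - t))
    (bound := fun t => |ρ t| * K) Filter.univ_mem ?_ ?_ ?_ ?_ ?_ ?_).2
  · intro z _
    exact (hρ.smul (hφ.continuous.comp (by fun_prop))).aestronglyMeasurable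
  · exact (hρ.smul (hφ.continuous.comp (by fun_prop))).integrable_of_hasCompactSupport
      hρc.smul_right
  · exact hρ.aestronglyMeasurable.smul
      ((measurable_fderiv ℝ φ).comp (by fun_prop)).aestronglyMeasurable
  · refine Eventually.of_forall fun t z _ => ?_
    rw [← smul_sub, norm_smul, Real.norm_eq_abs, mul_assoc]
    gcongr
    simpa using hφ.norm_sub_le (z - t) (x - t)
  · exact hρi.abs.mul_const _
  · have h : ∀ᵐ t : E, DifferentiableAt ℝ φ (x - t) :=
      (Measure.measurePreserving_sub_left volume x).quasiMeasurePreserving.ae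
        hφ.ae_differentiableAt
    filter_upwards [h] with t ht
    have h2 : HasFDerivAt (fun z => φ (z - t)) (fderiv ℝ φ (x - t)) x := by
      have h3 := ht.hasFDerivAt.comp x ((hasFDerivAt_id x).sub_const t)
      rwa [ContinuousLinearMap.comp_id] at h3
    exact h2.const_smul (ρ t)

lemma ContDiffBump.norm_normed_convolution_le {V : Type*} [NormedAddCommGroup V] [NormedSpace ℝ V]
    (b : ContDiffBump (0 : E)) {f : E → V} {c : ℝ} (hf : ∀ x, ‖f x‖ ≤ c) (x : E) :
    ‖convolution (b.normed volume) f (ContinuousLinearMap.lsmul ℝ ℝ) volume x‖ ≤ c := by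
  calc _ ≤ ∫ t, b.normed volume t * c := by
          refine norm_integral_le_of_norm_le (b.integrable_normed.mul_const c)
            (Eventually.of_forall fun t => ?_)
          simp only [ContinuousLinearMap.lsmul_apply, norm_smul, Real.norm_eq_abs,
            abs_of_nonneg (b.nonneg_normed t)]
          exact mul_le_mul_of_nonneg_left (hf _) (b.nonneg_normed t)
    _ = c := by rw [integral_mul_const, b.integral_normed, one_mul]

/-- Weak inequalities tested against nonnegative smooth functions extend to nonnegative Lipschitz
test functions. -/
lemma integral_nonneg_of_lipschitz_test {U : Set E} (hU : IsOpen U) {G : E → E} {F : E → ℝ}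
    {A B : ℝ} (hG : AEStronglyMeasurable G) (hF : AEStronglyMeasurable F)
    (hGA : ∀ x, ‖G x‖ ≤ A) (hFB : ∀ x, |F x| ≤ B)
    (h : ∀ φ : E → ℝ, ContDiff ℝ (⊤ : ℕ∞) φ → HasCompactSupport φ → tsupport φ ⊆ U →
      (∀ x, 0 ≤ φ x) → 0 ≤ ∫ x, (-⟪G x, gradient φ x⟫ + F x * φ x))
    {φ : E → ℝ} {K : NNReal} (hφ : LipschitzWith K φ) (hφc : HasCompactSupport φ)
    (hφU : tsupport φ ⊆ U) (hφ0 : ∀ x, 0 ≤ φ x) :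
    0 ≤ ∫ x, (-⟪G x, gradient φ x⟫ + F x * φ x) := by
  obtain ⟨M, hM⟩ : ∃ M, ∀ x, ‖φ x‖ ≤ M := hφc.exists_bound_of_continuous hφ.continuous
  obtain ⟨δ, hδ, hδU⟩ := hφc.isCompact.exists_cthickening_subset_open hU hφU
  have hT : IsCompact (cthickening δ (tsupport φ)) := hφc.isCompact.cthickening
  have hA : 0 ≤ A := (norm_nonneg _).trans (hGA 0)
  have hB : 0 ≤ B := (abs_nonneg _).trans (hFB 0)
  let b : ℕ → ContDiffBump (0 : E) := fun k =>
    ⟨δ / (2 * ((k : ℝ) + 1)), δ / ((k : ℝ) + 1), by positivity, by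
      gcongr
      have : (0 : ℝ) ≤ k := k.cast_nonneg
      linarith⟩
  have hout : ∀ k, (b k).rOut ≤ δ := fun k => by
    have : (0 : ℝ) ≤ k := k.cast_nonneg
    exact div_le_self hδ.le (by linarith)
  have htend : Tendsto (fun k => (b k).rOut) atTop (nhds 0) := by
    have := (tendsto_one_div_add_atTop_nhds_zero_nat (𝕜 := ℝ)).const_mul δ
    simpa [b, div_eq_mul_inv] using this
  let ψ : ℕ → E → ℝ := fun k => convolution ((b k).normed volume) φ
    (ContinuousLinearMap.lsmul ℝ ℝ) volume
  have hψsmooth : ∀ k, ContDiff ℝ (⊤ : ℕ∞) (ψ k) := fun k =>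
    (b k).hasCompactSupport_normed.contDiff_convolution_left _ (b k).contDiff_normed
      hφ.continuous.locallyIntegrable
  have hsupp : ∀ k, tsupport (ψ k) ⊆ cthickening δ (tsupport φ) := by
    intro k
    refine closure_minimal ?_ isClosed_cthickening
    refine (support_convolution_subset _).trans ?_
    rw [(b k).support_normed_eq]
    rintro _ ⟨y, hy, z, hz, rfl⟩
    refine mem_cthickening_of_dist_le (y + z) z δ _ (subset_tsupport _ hz) ?_
    have : ‖y‖ < (b k).rOut := by simpa using hy
    simpa using this.le.trans (hout k)
  have hψ0 : ∀ k x, 0 ≤ ψ k x := fun k x =>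
    integral_nonneg fun t => by
      simpa using mul_nonneg ((b k).nonneg_normed t) (hφ0 _)
  have hψfd : ∀ k x, fderiv ℝ (ψ k) x = convolution ((b k).normed volume) (fderiv ℝ φ)
      (ContinuousLinearMap.lsmul ℝ ℝ) volume x := fun k x =>
    (hasFDerivAt_convolution_of_lipschitz (b k).continuous_normed (b k).hasCompactSupport_normed
      hφ x).fderiv
  have hψM : ∀ k x, ‖ψ k x‖ ≤ M := fun k => (b k).norm_normed_convolution_le hM
  have hψK : ∀ k x, ‖fderiv ℝ (ψ k) x‖ ≤ K := fun k x => by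
    rw [hψfd]
    exact (b k).norm_normed_convolution_le (fun _ => norm_fderiv_le_of_lipschitz ℝ hφ) x
  have hloc : LocallyIntegrable (fderiv ℝ φ) (volume : Measure E) := by
    refine (locallyIntegrable_const (K : ℝ)).mono
      (measurable_fderiv ℝ φ).aestronglyMeasurable (Eventually.of_forall fun x => ?_)
    simpa using norm_fderiv_le_of_lipschitz ℝ hφ (x₀ := x)
  have hratio : ∀ᶠ k in atTop, (b k).rOut ≤ 2 * (b k).rIn := Eventually.of_forall fun k => by
    simp only [b]
    apply le_of_eq
    field_simp
  have hlim : Tendsto (fun k => ∫ x, (-⟪G x, gradient (ψ k) x⟫ + F x * ψ k x)) atTop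
      (nhds (∫ x, (-⟪G x, gradient φ x⟫ + F x * φ x))) := by
    refine tendsto_integral_of_dominated_convergence
      ((cthickening δ (tsupport φ)).indicator fun _ => A * K + B * M) ?_ ?_ ?_ ?_
    · intro k
      exact (hG.inner (measurable_gradient_real _).aestronglyMeasurable).neg.add
        (hF.mul (hψsmooth k).continuous.aestronglyMeasurable)
    · rw [integrable_indicator_iff hT.isClosed.measurableSet]
      exact integrableOn_const hT.measure_lt_top.ne
    · intro k
      refine Eventually.of_forall fun x => ?_
      by_cases hx : x ∈ cthickening δ (tsupport φ)
      · rw [Set.indicator_of_mem hx, inner_gradient_eq_fderiv]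
        refine (norm_add_le _ _).trans (add_le_add ?_ ?_)
        · rw [norm_neg, mul_comm]
          exact ((fderiv ℝ (ψ k) x).le_opNorm _).trans (by
            gcongr
            exacts [hψK k x, hGA x])
        · rw [norm_mul]
          exact mul_le_mul (hFB x) (hψM k x) (norm_nonneg _) hB
      · have hx' : x ∉ tsupport (ψ k) := fun h' => hx (hsupp k h')
        rw [Set.indicator_of_notMem hx, inner_gradient_eq_fderiv,
          image_eq_zero_of_notMem_tsupport hx',
          fderiv_of_notMem_tsupport ℝ hx']
        simp
    · filter_upwards [ContDiffBump.ae_convolution_tendsto_right_of_locallyIntegrable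
        htend hratio hloc] with x hx
      simp only [inner_gradient_eq_fderiv]
      refine Tendsto.add (Tendsto.neg ?_) (Tendsto.const_mul _ ?_)
      · simp only [hψfd]
        exact ((ContinuousLinearMap.apply ℝ ℝ (G x)).continuous.tendsto _).comp hx
      · exact ContDiffBump.convolution_tendsto_right_of_continuous htend hφ.continuous x
  refine ge_of_tendsto' hlim fun k => h _ (hψsmooth k) ?_ ((hsupp k).trans hδU) (hψ0 k)
  exact hT.of_isClosed_subset (isClosed_tsupport _) (hsupp k)

end Mollification

lemma norm_add_smul_sq_le {V : Type*} [NormedAddCommGroup V] [InnerProductSpace ℝ V] {p : ℝ}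
    (hp : 1 < p) (a b : V) :
    ‖a + (p / 2) • b‖ ^ 2 ≤ (2 + 2 * p ^ 2 / (p - 1) ^ 2) * ‖a‖ ^ 2
      + p ^ 2 / (p - 1) * (2 * ⟪a, b⟫ + (p - 1) * ‖b‖ ^ 2) := by
  have h1 : 0 ≤ ‖a - (p / 2) • b‖ ^ 2 := sq_nonneg _
  have h2 : 0 ≤ ‖(2 : ℝ) • a + (p - 1) • b‖ ^ 2 := sq_nonneg _
  have hp1 : 0 < p - 1 := by linarith
  rw [norm_sub_sq_real, norm_smul, inner_smul_right, mul_pow, Real.norm_eq_abs, sq_abs] at h1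
  rw [norm_add_sq_real, norm_smul, norm_smul, inner_smul_left, inner_smul_right, mul_pow, mul_pow,
    Real.norm_eq_abs, Real.norm_eq_abs, sq_abs, sq_abs] at h2
  rw [norm_add_sq_real, norm_smul, inner_smul_right, mul_pow, Real.norm_eq_abs, sq_abs]
  simp only [conj_trivial] at h2
  have h3 := mul_nonneg (show 0 ≤ p ^ 2 / (2 * (p - 1) ^ 2) by positivity) h2
  have h4 : (2 + 2 * p ^ 2 / (p - 1) ^ 2) * ‖a‖ ^ 2
      + p ^ 2 / (p - 1) * (2 * ⟪a, b⟫ + (p - 1) * ‖b‖ ^ 2) =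
      2 * ‖a‖ ^ 2 + p ^ 2 / 2 * ‖b‖ ^ 2 + p ^ 2 / (2 * (p - 1) ^ 2) *
      (2 ^ 2 * ‖a‖ ^ 2 + 2 * (2 * ((p - 1) * ⟪a, b⟫)) + (p - 1) ^ 2 * ‖b‖ ^ 2) := by
    field_simp
    ring
  rw [h4]
  nlinarith

section Gradient

variable {E : Type*} [NormedAddCommGroup E] [InnerProductSpace ℝ E] [CompleteSpace E]

lemma gradient_mul_rpow {η g : E → ℝ} {x : E} (hη : DifferentiableAt ℝ η x)
    (hg : DifferentiableAt ℝ g x) (h0 : 0 < g x) (s : ℝ) :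
    gradient (fun y => η y * g y ^ s) x =
      g x ^ s • gradient η x + (η x * (s * g x ^ (s - 1))) • gradient g x := by
  have h := hη.hasFDerivAt.mul (hg.hasFDerivAt.rpow_const (p := s) (Or.inl h0.ne'))
  have h' := h.fderiv
  rw [gradient, show (fun y => η y * g y ^ s) = (η * fun y => g y ^ s) from rfl, h',
    map_add, smul_smul, map_smul, map_smul, gradient, gradient, add_comm]

lemma gradient_sq_mul_rpow {η g : E → ℝ} {x : E} (hη : DifferentiableAt ℝ η x)
    (hg : DifferentiableAt ℝ g x) (h0 : 0 < g x) (s : ℝ) :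
    gradient (fun y => η y ^ 2 * g y ^ s) x =
      (2 * η x * g x ^ s) • gradient η x + (η x ^ 2 * (s * g x ^ (s - 1))) • gradient g x := by
  have e : gradient (fun y => η y ^ 2) x = (2 * η x) • gradient η x := by
    rw [gradient, (hη.hasFDerivAt.pow 2).fderiv, map_smul, gradient]
    simp
  refine (gradient_mul_rpow (η := fun y => η y ^ 2) (hη.pow 2) hg h0 s).trans ?_
  rw [e, smul_smul]
  congr 2
  ring

lemma gradient_of_notMem_tsupport {f : E → ℝ} {x : E} (hx : x ∉ tsupport f) :
    gradient f x = 0 := by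
  rw [gradient, fderiv_of_notMem_tsupport ℝ hx, map_zero]

end Gradient

/-- Composite of a pair of bounded Lipschitz functions with a function that is `C¹` on the
rectangle containing their values. -/
lemma exists_lipschitzWith_comp_pair {E : Type*} [PseudoMetricSpace E] {η g : E → ℝ}
    {Kη Kg : NNReal} {a b c d : ℝ}
    (hη : LipschitzWith Kη η) (hg : LipschitzWith Kg g) (hηb : ∀ x, η x ∈ Set.Icc a b)
    (hgb : ∀ x, g x ∈ Set.Icc c d) {H : ℝ × ℝ → ℝ}
    (hH : ContDiffOn ℝ 1 H (Set.Icc a b ×ˢ Set.Icc c d)) :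
    ∃ K, LipschitzWith K fun x => H (η x, g x) := by
  obtain ⟨K, hK⟩ := hH.exists_lipschitzOnWith one_ne_zero ((convex_Icc a b).prod (convex_Icc c d))
    (isCompact_Icc.prod isCompact_Icc)
  refine ⟨K * max Kη Kg, ?_⟩
  rw [← lipschitzOnWith_univ]
  exact hK.comp (lipschitzOnWith_univ.2 (hη.prodMk hg)) fun x _ => ⟨hηb x, hgb x⟩

lemma integrable_of_bound_of_eq_zero {X : Type*} [TopologicalSpace X] [T2Space X]
    [MeasurableSpace X] [BorelSpace X] {μ : Measure X} [IsFiniteMeasureOnCompacts μ] {S : Set X}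
    (hS : IsCompact S) {f : X → ℝ} {c : ℝ} (hf : AEStronglyMeasurable f μ)
    (hb : ∀ x ∈ S, |f x| ≤ c) (h0 : ∀ x, x ∉ S → f x = 0) : Integrable f μ := by
  have h := (IntegrableOn.of_bound hS.measure_lt_top hf.restrict c
    (ae_restrict_of_forall_mem hS.measurableSet hb))
  exact (integrableOn_iff_integrable_of_support_subset fun x hx => by
    by_contra hxS
    exact hx (h0 x hxS)).1 h

/-- Hölder's inequality with exponents `n / 2` and `n / (n - 2)`, in the form used to absorb the
nonlinear term. -/
lemma setIntegral_rpow_mul_sq_le {X : Type*} [TopologicalSpace X] [T2Space X]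
    [MeasurableSpace X] [BorelSpace X] {μ : Measure X} [IsFiniteMeasureOnCompacts μ] {S : Set X}
    (hS : IsCompact S) {N p M : ℝ} (hN : 2 < N) {g w : X → ℝ} (hg : Measurable g)
    (hw : Measurable w) (hp : 0 < p) (hg0 : ∀ x, 0 < g x) (hgM : ∀ x, g x ≤ M)
    (hwM : ∀ x, |w x| ≤ M) (hw0 : ∀ x, x ∉ S → w x = 0) :
    ∫ x, g x ^ (2 * p / N) * w x ^ 2 ∂μ ≤ (∫ x in S, g x ^ p ∂μ) ^ (2 / N) *
      (∫ x, |w x| ^ (2 * N / (N - 2)) ∂μ) ^ ((N - 2) / N) := by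
  have hNpos : 0 < N := by linarith
  have hN2 : 0 < N - 2 := by linarith
  have hfin : IsFiniteMeasure (μ.restrict S) := ⟨by simpa using hS.measure_lt_top⟩
  have hconj : (N / 2).HolderConjugate (N / (N - 2)) := by
    rw [Real.holderConjugate_iff]
    refine ⟨by linarith, ?_⟩
    field_simp
    ring
  have key := integral_mul_le_Lp_mul_Lq_of_nonneg (μ := μ.restrict S) hconj
    (f := fun x => g x ^ (2 * p / N)) (g := fun x => w x ^ 2)
    (Eventually.of_forall fun x => (Real.rpow_pos_of_pos (hg0 x) _).le)
    (Eventually.of_forall fun x => sq_nonneg _)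
    (MemLp.of_bound (hg.pow_const _).aestronglyMeasurable (M ^ (2 * p / N))
      (Eventually.of_forall fun x => by
        rw [Real.norm_eq_abs, abs_of_pos (Real.rpow_pos_of_pos (hg0 x) _)]
        exact Real.rpow_le_rpow (hg0 x).le (hgM x) (by positivity)))
    (MemLp.of_bound (hw.pow_const _).aestronglyMeasurable (M ^ 2)
      (Eventually.of_forall fun x => by
        rw [norm_pow, Real.norm_eq_abs]
        exact pow_le_pow_left₀ (abs_nonneg _) (hwM x) 2))
  have e1 : ∫ x, g x ^ (2 * p / N) * w x ^ 2 ∂μ = ∫ x in S, g x ^ (2 * p / N) * w x ^ 2 ∂μ :=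
    (setIntegral_eq_integral_of_forall_compl_eq_zero fun x hx => by simp [hw0 x hx]).symm
  have e2 : ∫ x, |w x| ^ (2 * N / (N - 2)) ∂μ = ∫ x in S, |w x| ^ (2 * N / (N - 2)) ∂μ :=
    (setIntegral_eq_integral_of_forall_compl_eq_zero fun x hx => by
      rw [hw0 x hx, abs_zero, Real.zero_rpow (by positivity)]).symm
  have e3 : ∀ x, (g x ^ (2 * p / N)) ^ (N / 2) = g x ^ p := fun x => by
    rw [← Real.rpow_mul (hg0 x).le]
    congr 1
    field_simp
  have e4 : ∀ x, (w x ^ 2) ^ (N / (N - 2)) = |w x| ^ (2 * N / (N - 2)) := fun x => by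
    rw [← sq_abs, ← Real.rpow_natCast, ← Real.rpow_mul (abs_nonneg _)]
    congr 1
    push_cast
    ring
  simp only [e3, e4, one_div, inv_div] at key
  rw [e1, e2]
  exact key

/-- Caccioppoli-type estimate followed by absorption, for a positive bounded Lipschitz function and
a Lipschitz cutoff `η`. -/
lemma sobolev_norm_cutoff_mul_rpow_le {n : ℕ} (hn : 3 ≤ n) {p q C0 Cs : ℝ} (hp : 1 < p)
    (hq : q = (2 * p + n) / n) (hC0 : 0 < C0) (hCs0 : 0 < Cs) (hCs : SobolevIneq n Cs)
    {g η : EuclideanSpace ℝ (Fin n) → ℝ} {K A : NNReal} {δ M : ℝ} (hδ : 0 < δ)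
    (hg : LipschitzWith K g) (hgδ : ∀ x, δ ≤ g x) (hgM : ∀ x, g x ≤ M)
    (hη : LipschitzWith A η) (hη0 : ∀ x, 0 ≤ η x) (hη1 : ∀ x, η x ≤ 1)
    (hηc : HasCompactSupport η)
    (hweak : ∀ (φ : EuclideanSpace ℝ (Fin n) → ℝ) (L : NNReal), LipschitzWith L φ →
      HasCompactSupport φ → tsupport φ ⊆ tsupport η → (∀ x, 0 ≤ φ x) →
      0 ≤ ∫ x, (-⟪gradient g x, gradient φ x⟫ + C0 * g x ^ q * φ x))
    (hsmall : p ^ 2 / (p - 1) * C0 * Cs * (∫ x in tsupport η, g x ^ p) ^ (2 / (n : ℝ)) ≤ 1 / 2) :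
    (∫ x, |η x * g x ^ (p / 2)| ^ ((2 * (n : ℝ)) / ((n : ℝ) - 2))) ^ (((n : ℝ) - 2) / (n : ℝ))
      ≤ 2 * (2 + 2 * p ^ 2 / (p - 1) ^ 2) * Cs * A ^ 2 * ∫ x in tsupport η, g x ^ p := by
  have hN : (3 : ℝ) ≤ n := by exact_mod_cast hn
  have hp1 : 0 < p - 1 := by linarith
  have hg0 : ∀ x, 0 < g x := fun x => hδ.trans_le (hgδ x)
  have hS : IsCompact (tsupport η) := hηc
  have hηz : ∀ x, x ∉ tsupport η → η x = 0 := fun x hx => image_eq_zero_of_notMem_tsupport hx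
  have hηb : ∀ x, η x ∈ Set.Icc (0 : ℝ) 1 := fun x => ⟨hη0 x, hη1 x⟩
  have hgb : ∀ x, g x ∈ Set.Icc δ M := fun x => ⟨hgδ x, hgM x⟩
  have hpow : ∀ s : ℝ, ContDiffOn ℝ 1 (fun z : ℝ × ℝ => z.2 ^ s)
      (Set.Icc (0 : ℝ) 1 ×ˢ Set.Icc δ M) := fun s =>
    contDiff_snd.contDiffOn.rpow_const_of_ne fun z hz => (hδ.trans_le hz.2.1).ne'
  have hpowle : ∀ (s : ℝ) (x), 0 ≤ s → g x ^ s ≤ M ^ s := fun s x hs =>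
    Real.rpow_le_rpow (hg0 x).le (hgM x) hs
  have hgp : ∀ (s : ℝ) (x), 0 < g x ^ s := fun s x => Real.rpow_pos_of_pos (hg0 x) s
  obtain ⟨Lw, hLw⟩ := exists_lipschitzWith_comp_pair hη hg hηb hgb
    (contDiff_fst.contDiffOn.mul (hpow (p / 2)))
  obtain ⟨Lφ, hLφ⟩ := exists_lipschitzWith_comp_pair hη hg hηb hgb
    ((contDiff_fst.pow 2).contDiffOn.mul (hpow (p - 1)))
  set w : EuclideanSpace ℝ (Fin n) → ℝ := fun x => η x * g x ^ (p / 2) with hw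
  set φ : EuclideanSpace ℝ (Fin n) → ℝ := fun x => η x ^ 2 * g x ^ (p - 1) with hφ
  replace hLw : LipschitzWith Lw w := hLw
  replace hLφ : LipschitzWith Lφ φ := hLφ
  have hwc : HasCompactSupport w := hηc.mul_right
  have hφS : tsupport φ ⊆ tsupport η := by
    refine closure_mono fun x hx => ?_
    contrapose! hx
    simp only [Function.mem_support, not_not] at hx
    simp [hφ, hx]
  have hφc : HasCompactSupport φ := hS.of_isClosed_subset (isClosed_tsupport _) hφS
  have hφ0 : ∀ x, 0 ≤ φ x := fun x => mul_nonneg (sq_nonneg _) (hgp _ x).le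
  set J := ∫ x in tsupport η, g x ^ p with hJ
  have hJ0 : 0 ≤ J := integral_nonneg fun x => (hgp p x).le
  set α := 2 + 2 * p ^ 2 / (p - 1) ^ 2 with hα
  set β := p ^ 2 / (p - 1) with hβ
  have hα0 : 0 < α := by positivity
  have hβ0 : 0 < β := by positivity
  set Sw := (∫ x, |w x| ^ ((2 * (n : ℝ)) / ((n : ℝ) - 2))) ^ (((n : ℝ) - 2) / (n : ℝ)) with hSw
  have hsob : Sw ≤ Cs * ∫ x, ‖gradient w x‖ ^ 2 := hCs w ⟨Lw, hLw⟩ hwc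
  have hgm : Measurable g := hg.continuous.measurable
  have hia : Integrable fun x => ‖g x ^ (p / 2) • gradient η x‖ ^ 2 := by
    refine integrable_of_bound_of_eq_zero (c := (M ^ (p / 2) * A) ^ 2) hS
      (((hgm.pow_const _).smul (measurable_gradient_real η)).norm.pow_const 2).aestronglyMeasurable
      (fun x _ => ?_) fun x hx => ?_
    · have hM0 : 0 < M := (hg0 x).trans_le (hgM x)
      rw [abs_of_nonneg (sq_nonneg _), norm_smul, Real.norm_eq_abs, abs_of_pos (hgp _ x)]
      have h1 := hpowle (p / 2) x (by linarith)
      have h2 := hη.norm_gradient_le x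
      have h3 := (hgp (p / 2) x).le
      gcongr
    · simp [gradient_of_notMem_tsupport hx]
  have hib : Integrable fun x => ⟪gradient g x, gradient φ x⟫ := by
    refine integrable_of_bound_of_eq_zero (c := K * Lφ) hS
      ((measurable_gradient_real g).inner (measurable_gradient_real φ)).aestronglyMeasurable
      (fun x _ => ?_) fun x hx => ?_
    · exact (abs_real_inner_le_norm _ _).trans (mul_le_mul (hg.norm_gradient_le x)
        (hLφ.norm_gradient_le x) (norm_nonneg _) K.coe_nonneg)
    · rw [gradient_of_notMem_tsupport fun h => hx (hφS h), inner_zero_right]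
  have hic : Integrable fun x => C0 * g x ^ q * φ x :=
    ((continuous_const.mul (hg.continuous.rpow_const fun x => Or.inl (hg0 x).ne')).mul
      hLφ.continuous).integrable_of_hasCompactSupport hφc.mul_left
  have hig : IntegrableOn (fun x => g x ^ p) (tsupport η) :=
    (hg.continuous.rpow_const fun x => Or.inl (hg0 x).ne').continuousOn.integrableOn_compact hS
  have hgrad : ∫ x, ‖gradient w x‖ ^ 2 ≤
      α * (∫ x, ‖g x ^ (p / 2) • gradient η x‖ ^ 2) + β * ∫ x, ⟪gradient g x, gradient φ x⟫ := by
    rw [← integral_const_mul, ← integral_const_mul, ← integral_add (hia.const_mul _)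
      (hib.const_mul _)]
    refine integral_mono_of_nonneg (Eventually.of_forall fun x => sq_nonneg _)
      ((hia.const_mul _).add (hib.const_mul _)) ?_
    filter_upwards [hη.ae_differentiableAt, hg.ae_differentiableAt] with x hx1 hx2
    have h := norm_add_smul_sq_le hp (g x ^ (p / 2) • gradient η x)
      ((η x * g x ^ (p / 2 - 1)) • gradient g x)
    have e1 : gradient w x = g x ^ (p / 2) • gradient η x +
        (p / 2) • (η x * g x ^ (p / 2 - 1)) • gradient g x := by
      rw [hw, gradient_mul_rpow hx1 hx2 (hg0 x), smul_smul]
      congr 2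
      ring
    have e2 : ⟪gradient g x, gradient φ x⟫ =
        2 * ⟪g x ^ (p / 2) • gradient η x, (η x * g x ^ (p / 2 - 1)) • gradient g x⟫ +
        (p - 1) * ‖(η x * g x ^ (p / 2 - 1)) • gradient g x‖ ^ 2 := by
      have t1 : g x ^ (p - 1) = g x ^ (p / 2) * g x ^ (p / 2 - 1) := by
        rw [← Real.rpow_add (hg0 x)]
        congr 1
        ring
      have t2 : g x ^ (p - 1 - 1) = g x ^ (p / 2 - 1) * g x ^ (p / 2 - 1) := by
        rw [← Real.rpow_add (hg0 x)]
        congr 1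
        ring
      rw [hφ, gradient_sq_mul_rpow hx1 hx2 (hg0 x), inner_add_right, inner_smul_right,
        inner_smul_right, real_inner_smul_left, inner_smul_right, real_inner_self_eq_norm_sq,
        norm_smul, mul_pow, Real.norm_eq_abs, sq_abs, t1, t2,
        real_inner_comm (gradient g x) (gradient η x)]
      ring
    rw [e1, e2]
    exact h
  have hcut : ∫ x, ‖g x ^ (p / 2) • gradient η x‖ ^ 2 ≤ A ^ 2 * J := by
    rw [hJ, ← integral_const_mul, ← setIntegral_eq_integral_of_forall_compl_eq_zero
      (s := tsupport η) fun x hx => by simp [gradient_of_notMem_tsupport hx]]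
    refine integral_mono hia.integrableOn (hig.const_mul _) fun x => ?_
    have t : g x ^ p = (g x ^ (p / 2)) ^ 2 := by
      rw [← Real.rpow_natCast, ← Real.rpow_mul (hg0 x).le]
      congr 1
      push_cast
      ring
    simp only [norm_smul, Real.norm_eq_abs, mul_pow, sq_abs]
    rw [t, mul_comm]
    gcongr
    exact hη.norm_gradient_le x
  have htest : ∫ x, ⟪gradient g x, gradient φ x⟫ ≤ C0 * (J ^ (2 / (n : ℝ)) * Sw) := by
    have h := hweak φ Lφ hLφ hφc hφS hφ0
    rw [integral_add (f := fun x => -⟪gradient g x, gradient φ x⟫) hib.neg hic, integral_neg] at h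
    have e : ∀ x, C0 * g x ^ q * φ x = C0 * (g x ^ (2 * p / (n : ℝ)) * w x ^ 2) := fun x => by
      have t : g x ^ q * g x ^ (p - 1) =
          g x ^ (2 * p / (n : ℝ)) * (g x ^ (p / 2) * g x ^ (p / 2)) := by
        simp only [← Real.rpow_add (hg0 x)]
        congr 1
        rw [hq]
        field_simp
        ring
      simp only [hφ, hw]
      linear_combination C0 * η x ^ 2 * t
    simp only [e] at h
    rw [integral_const_mul] at h
    refine (show _ ≤ C0 * ∫ x, g x ^ (2 * p / (n : ℝ)) * w x ^ 2 by linarith).trans ?_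
    refine mul_le_mul_of_nonneg_left ?_ hC0.le
    refine setIntegral_rpow_mul_sq_le (M := max M (M ^ (p / 2))) hS (by linarith) hgm
      hLw.continuous.measurable (by linarith) hg0 (fun x => (hgM x).trans (le_max_left _ _))
      (fun x => ?_) fun x hx => by simp [hw, hηz x hx]
    rw [abs_of_nonneg (mul_nonneg (hη0 x) (hgp _ x).le)]
    refine le_trans ?_ (le_max_right _ _)
    exact (mul_le_of_le_one_left (hgp _ x).le (hη1 x)).trans (hpowle _ x (by linarith))
  set D := ∫ x, ‖gradient w x‖ ^ 2 with hD
  have hD0 : 0 ≤ D := integral_nonneg fun x => sq_nonneg _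
  have hJn : 0 ≤ J ^ (2 / (n : ℝ)) := Real.rpow_nonneg hJ0 _
  have h1 : β * (C0 * (J ^ (2 / (n : ℝ)) * Sw)) ≤ D / 2 := by
    calc β * (C0 * (J ^ (2 / (n : ℝ)) * Sw)) ≤ β * (C0 * (J ^ (2 / (n : ℝ)) * (Cs * D))) := by
          gcongr
      _ = β * C0 * Cs * J ^ (2 / (n : ℝ)) * D := by ring
      _ ≤ 1 / 2 * D := by gcongr
      _ = D / 2 := by ring
  have h2 : D ≤ α * (A ^ 2 * J) + D / 2 := by
    refine hgrad.trans (add_le_add (mul_le_mul_of_nonneg_left hcut hα0.le) ?_)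
    exact (mul_le_mul_of_nonneg_left htest hβ0.le).trans h1
  calc Sw ≤ Cs * D := hsob
    _ ≤ Cs * (2 * (α * (A ^ 2 * J))) := by
      gcongr
      linarith
    _ = 2 * α * Cs * A ^ 2 * J := by ring

lemma exists_lipschitz_cutoff {E : Type*} [NormedAddCommGroup E] {r : ℝ} (hr : 0 < r) :
    ∃ η : E → ℝ, LipschitzWith (4 / r).toNNReal η ∧ (∀ x, 0 ≤ η x) ∧ (∀ x, η x ≤ 1) ∧
      (∀ x ∈ ball (0 : E) (r / 2), η x = 1) ∧ tsupport η ⊆ closedBall 0 (3 * r / 4) := by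
  have h4 : 0 ≤ 4 / r := by positivity
  refine ⟨fun x => max 0 (min 1 (3 - 4 / r * ‖x‖)), ?_, fun x => le_max_left _ _,
    fun x => max_le zero_le_one (min_le_left _ _), fun x hx => ?_, ?_⟩
  · refine LipschitzWith.const_max (LipschitzWith.const_min ?_ 1) 0
    refine LipschitzWith.of_dist_le_mul fun x y => ?_
    rw [Real.coe_toNNReal _ h4, Real.dist_eq, show 3 - 4 / r * ‖x‖ - (3 - 4 / r * ‖y‖) =
      -(4 / r * (‖x‖ - ‖y‖)) by ring, abs_neg, abs_mul, abs_of_nonneg h4, dist_eq_norm]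
    gcongr
    exact abs_norm_sub_norm_le x y
  · have hx' : ‖x‖ < r / 2 := by simpa using hx
    have : 4 / r * ‖x‖ ≤ 4 / r * (r / 2) := by gcongr
    have e : 4 / r * (r / 2) = 2 := by field_simp; norm_num
    dsimp only
    rw [min_eq_left (by linarith), max_eq_right zero_le_one]
  · refine closure_minimal (fun x hx => ?_) isClosed_closedBall
    contrapose! hx
    have hx' : 3 * r / 4 < ‖x‖ := by simpa using hx
    have : 4 / r * (3 * r / 4) ≤ 4 / r * ‖x‖ := by gcongr
    have e : 4 / r * (3 * r / 4) = 3 := by field_simp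
    simp only [Function.mem_support, not_not]
    exact max_eq_left ((min_le_right _ _).trans (by linarith))

/-- A nonnegative locally Lipschitz function agrees on a compact set with a bounded nonnegative
globally Lipschitz function. -/
lemma exists_bounded_lipschitz_eqOn {X : Type*} [PseudoMetricSpace X] {s : Set X}
    (hs : IsCompact s) {u : X → ℝ} (hu : LocallyLipschitzOn s u) (hu0 : ∀ x ∈ s, 0 ≤ u x) :
    ∃ (g : X → ℝ) (K : NNReal) (M : ℝ), LipschitzWith K g ∧ (∀ x, 0 ≤ g x) ∧ (∀ x, g x ≤ M) ∧
      Set.EqOn u g s := by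
  obtain ⟨K, hK⟩ := hu.exists_lipschitzOnWith_of_compact hs
  obtain ⟨g, hg, hug⟩ := hK.extend_real
  obtain ⟨M, hM⟩ := hs.exists_bound_of_continuousOn hK.continuousOn
  refine ⟨fun x => max 0 (min |M| (g x)), K, |M|, (hg.const_min _).const_max _,
    fun x => le_max_left _ _, fun x => max_le (abs_nonneg _) (min_le_left _ _), fun x hx => ?_⟩
  have h1 : g x ≤ |M| := by
    rw [← hug hx]
    exact (le_abs_self _).trans ((hM x hx).trans (le_abs_self M))
  have h2 : 0 ≤ g x := hug hx ▸ hu0 x hx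
  simp only [min_eq_right h1, max_eq_right h2]
  exact hug hx

lemma integrable_weak_integrand {E : Type*} [NormedAddCommGroup E] [InnerProductSpace ℝ E]
    [FiniteDimensional ℝ E] [MeasurableSpace E] [BorelSpace E] {G : E → E} {F φ : E → ℝ}
    {A B : ℝ} {K : NNReal} (hG : AEStronglyMeasurable G) (hF : AEStronglyMeasurable F)
    (hGA : ∀ x, ‖G x‖ ≤ A) (hFB : ∀ x, |F x| ≤ B) (hφ : LipschitzWith K φ)
    (hφc : HasCompactSupport φ) :
    Integrable fun x => -⟪G x, gradient φ x⟫ + F x * φ x := by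
  obtain ⟨M, hM⟩ : ∃ M, ∀ x, ‖φ x‖ ≤ M := hφc.exists_bound_of_continuous hφ.continuous
  refine integrable_of_bound_of_eq_zero (c := A * K + B * M) hφc
    ((hG.inner (measurable_gradient_real _).aestronglyMeasurable).neg.add
      (hF.mul hφ.continuous.aestronglyMeasurable)) (fun x _ => ?_) fun x hx => ?_
  · refine (abs_add_le _ _).trans (add_le_add ?_ ?_)
    · rw [abs_neg]
      exact (abs_real_inner_le_norm _ _).trans (mul_le_mul (hGA x) (hφ.norm_gradient_le x)
        (norm_nonneg _) ((norm_nonneg _).trans (hGA x)))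
    · rw [abs_mul]
      exact mul_le_mul (hFB x) (hM x) (abs_nonneg _) ((abs_nonneg _).trans (hFB x))
  · rw [gradient_of_notMem_tsupport hx, image_eq_zero_of_notMem_tsupport hx]
    simp

/-- The weak inequality for `u` passes to a global Lipschitz function agreeing with `u` on a
smaller ball, and to Lipschitz test functions. -/
lemma IsWeakSupersol.integral_nonneg_of_eqOn {n : ℕ} {C0 q ρ r M : ℝ} {K L : NNReal}
    {u g φ : EuclideanSpace ℝ (Fin n) → ℝ}
    (hu : IsWeakSupersol (ball 0 r) u fun x => C0 * u x ^ q) (hC0 : 0 ≤ C0) (hq : 0 ≤ q)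
    (hρ : ρ ≤ r) (hg : LipschitzWith K g) (hg0 : ∀ x, 0 ≤ g x) (hgM : ∀ x, g x ≤ M)
    (hug : Set.EqOn u g (ball 0 ρ)) (hφ : LipschitzWith L φ) (hφc : HasCompactSupport φ)
    (hφρ : tsupport φ ⊆ ball 0 ρ) (hφ0 : ∀ x, 0 ≤ φ x) :
    0 ≤ ∫ x, (-⟪gradient g x, gradient φ x⟫ + C0 * g x ^ q * φ x) := by
  refine integral_nonneg_of_lipschitz_test (F := fun x => C0 * g x ^ q) isOpen_ball
    (measurable_gradient_real g).aestronglyMeasurable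
    ((hg.continuous.measurable.pow_const q).const_mul C0).aestronglyMeasurable
    (fun x => hg.norm_gradient_le x) (B := C0 * M ^ q) (fun x => ?_) ?_ hφ hφc hφρ hφ0
  · rw [abs_of_nonneg (mul_nonneg hC0 (Real.rpow_nonneg (hg0 x) q))]
    exact mul_le_mul_of_nonneg_left (Real.rpow_le_rpow (hg0 x) (hgM x) hq) hC0
  · intro ψ hψ hψc hψρ hψ0
    have hsub : ball (0 : EuclideanSpace ℝ (Fin n)) ρ ⊆ ball 0 r := ball_subset_ball hρ
    have h := hu ψ hψ hψc (by rw [isOpen_ball.interior_eq]; exact hψρ.trans hsub) hψ0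
    have e : ∀ x, -⟪gradient u x, gradient ψ x⟫ + C0 * u x ^ q * ψ x =
        -⟪gradient g x, gradient ψ x⟫ + C0 * g x ^ q * ψ x := fun x => by
      by_cases hx : x ∈ tsupport ψ
      · have hx' := hψρ hx
        have hev : u =ᶠ[nhds x] g := hug.eventuallyEq_of_mem (isOpen_ball.mem_nhds hx')
        rw [hug hx', gradient, gradient, gradient, hev.fderiv_eq]
      · rw [gradient_of_notMem_tsupport hx, image_eq_zero_of_notMem_tsupport hx]
        simp
    simp only [e] at h
    rwa [setIntegral_eq_integral_of_forall_compl_eq_zero fun x hx => by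
      have hx' : x ∉ tsupport ψ := fun h' => hx (hsub (hψρ h'))
      rw [gradient_of_notMem_tsupport hx', image_eq_zero_of_notMem_tsupport hx']
      simp] at h

lemma tendsto_setIntegral_add_const_rpow {X : Type*} [TopologicalSpace X] [T2Space X]
    [MeasurableSpace X] [BorelSpace X] {μ : Measure X} [IsFiniteMeasureOnCompacts μ] {S : Set X}
    (hS : IsCompact S) {g : X → ℝ} {p M : ℝ} (hg : Measurable g) (hg0 : ∀ x, 0 ≤ g x)
    (hgM : ∀ x, g x ≤ M) (hp : 0 ≤ p) :
    Tendsto (fun δ : ℝ => ∫ x in S, (g x + δ) ^ p ∂μ) (nhdsWithin 0 (Set.Ioi 0))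
      (nhds (∫ x in S, g x ^ p ∂μ)) := by
  refine tendsto_integral_filter_of_dominated_convergence (fun _ => (M + 1) ^ p)
    (Eventually.of_forall fun δ => ((hg.add_const δ).pow_const p).aestronglyMeasurable) ?_
    (integrableOn_const hS.measure_lt_top.ne) (Eventually.of_forall fun x => ?_)
  · filter_upwards [Ioo_mem_nhdsGT (zero_lt_one' ℝ)] with δ hδ
    refine Eventually.of_forall fun x => ?_
    have h0 : 0 ≤ g x + δ := add_nonneg (hg0 x) hδ.1.le
    rw [Real.norm_eq_abs, abs_of_nonneg (Real.rpow_nonneg h0 p)]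
    exact Real.rpow_le_rpow h0 (add_le_add (hgM x) hδ.2.le) hp
  · have h : Continuous fun δ : ℝ => (g x + δ) ^ p :=
      (continuous_const.add continuous_id).rpow_const fun _ => Or.inr hp
    have h' := h.tendsto 0
    rw [add_zero] at h'
    exact h'.mono_left nhdsWithin_le_nhds

/-- **Reverse Hölder inequality.** Let `p > 1`, `q = (2p+n)/n`, `C₀ > 0`. There exist
`ε, C > 0` depending only on `n, p, Cs, C₀` such that any nonnegative locally Lipschitz
`u ∈ Lᵖ(B_r)` with `Δu + C₀ u^q ≥ 0` weakly in `B_r` and `∫_{B_r} uᵖ < ε` satisfies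
`(∫_{B_{r/2}} u^{pn/(n-2)})^{(n-2)/n} ≤ (C/r²) ∫_{B_r} uᵖ`. -/
theorem reverse_holder
    (n : ℕ) (hn : 3 ≤ n) (p q C0 Cs : ℝ) (hp : 1 < p) (hq : q = (2 * p + n) / n)
    (hC0 : 0 < C0) (hCs : SobolevIneq n Cs) :
    ∃ ε > (0 : ℝ), ∃ C > (0 : ℝ), ∀ r : ℝ, 0 < r →
      ∀ u : EuclideanSpace ℝ (Fin n) → ℝ,
      (∀ x ∈ ball (0 : EuclideanSpace ℝ (Fin n)) r, 0 ≤ u x) →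
      LocallyLipschitzOn (ball 0 r) u →
      IntegrableOn (fun x => u x ^ p) (ball (0 : EuclideanSpace ℝ (Fin n)) r) →
      IsWeakSupersol (ball 0 r) u (fun x => C0 * u x ^ q) →
      (∫ x in ball (0 : EuclideanSpace ℝ (Fin n)) r, u x ^ p) < ε →
      (∫ x in ball (0 : EuclideanSpace ℝ (Fin n)) (r / 2),
          u x ^ (p * ((n : ℝ) / ((n : ℝ) - 2)))) ^ (((n : ℝ) - 2) / (n : ℝ))
        ≤ (C / r ^ 2) * ∫ x in ball (0 : EuclideanSpace ℝ (Fin n)) r, u x ^ p := by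
  have hN : (3 : ℝ) ≤ n := by exact_mod_cast hn
  have hp1 : 0 < p - 1 := by linarith
  have hq0 : 0 ≤ q := by rw [hq]; positivity
  obtain ⟨Cs', hCs0', hCs'⟩ : ∃ C' > 0, SobolevIneq n C' :=
    ⟨max Cs 1, by positivity, fun w hw hwc => (hCs w hw hwc).trans
      (mul_le_mul_of_nonneg_right (le_max_left _ _) (integral_nonneg fun x => sq_nonneg _))⟩
  set β := p ^ 2 / (p - 1) with hβ
  have hβ0 : 0 < β := by positivity
  set ε := (1 / (2 * (β * C0 * Cs'))) ^ ((n : ℝ) / 2) with hε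
  refine ⟨ε, by positivity, 32 * (2 + 2 * p ^ 2 / (p - 1) ^ 2) * Cs', by positivity, ?_⟩
  intro r hr u hu0 hu hup hweak hsmall
  obtain ⟨η, hη, hη0, hη1, hηone, hηS⟩ :=
    exists_lipschitz_cutoff (E := EuclideanSpace ℝ (Fin n)) hr
  have hηc : HasCompactSupport η :=
    (isCompact_closedBall _ _).of_isClosed_subset (isClosed_tsupport _) hηS
  have hsub : closedBall (0 : EuclideanSpace ℝ (Fin n)) (7 * r / 8) ⊆ ball 0 r :=
    closedBall_subset_ball (by linarith)
  have hηρ : tsupport η ⊆ ball 0 (7 * r / 8) :=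
    hηS.trans (closedBall_subset_ball (by linarith))
  have hηcl : tsupport η ⊆ closedBall 0 (7 * r / 8) := hηρ.trans ball_subset_closedBall
  obtain ⟨g, K, M, hg, hg0, hgM, hug⟩ := exists_bounded_lipschitz_eqOn
    (isCompact_closedBall (0 : EuclideanSpace ℝ (Fin n)) (7 * r / 8)) (hu.mono hsub)
    fun x hx => hu0 x (hsub hx)
  have hJle : ∫ x in tsupport η, g x ^ p ≤ ∫ x in ball 0 r, u x ^ p := by
    rw [← setIntegral_congr_fun (isClosed_tsupport η).measurableSet
      (f := fun x => u x ^ p) fun x hx => by simp only [hug (hηcl hx)]]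
    refine setIntegral_mono_set hup ?_ (hηcl.trans hsub).eventuallyLE
    exact ae_restrict_of_forall_mem measurableSet_ball fun x hx => Real.rpow_nonneg (hu0 x hx) p
  have hlim := tendsto_setIntegral_add_const_rpow (μ := volume) hηc hg.continuous.measurable hg0
    hgM (p := p) (by linarith)
  have hest : ∀ᶠ δ in nhdsWithin (0 : ℝ) (Set.Ioi 0),
      (∫ x in ball (0 : EuclideanSpace ℝ (Fin n)) (r / 2),
          u x ^ (p * ((n : ℝ) / ((n : ℝ) - 2)))) ^ (((n : ℝ) - 2) / (n : ℝ)) ≤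
        32 * (2 + 2 * p ^ 2 / (p - 1) ^ 2) * Cs' / r ^ 2 *
          ∫ x in tsupport η, (g x + δ) ^ p := by
    filter_upwards [hlim.eventually_lt_const (hJle.trans_lt hsmall), self_mem_nhdsWithin]
      with δ hJδ hδ
    replace hδ : 0 < δ := hδ
    have hgδ : LipschitzWith K fun x => g x + δ := by
      simpa using hg.add (LipschitzWith.const δ)
    have hgrad : ∀ x, gradient (fun y => g y + δ) x = gradient g x := fun x => by
      rw [gradient, gradient, fderiv_add_const]
    have hpos : ∀ x, 0 < g x + δ := fun x => add_pos_of_nonneg_of_pos (hg0 x) hδ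
    have key := sobolev_norm_cutoff_mul_rpow_le hn hp hq hC0 hCs0' hCs' hδ hgδ
      (fun x => by linarith [hg0 x]) (M := M + δ) (fun x => by linarith [hgM x]) hη hη0 hη1 hηc
      (fun φ L hφ hφc hφη hφ0 => by
        have hF : ∀ (c : ℝ), 0 ≤ c → ∀ x, |C0 * (g x + c) ^ q| ≤ C0 * (M + c) ^ q := fun c hc x => by
          rw [abs_of_nonneg (mul_nonneg hC0.le (Real.rpow_nonneg (add_nonneg (hg0 x) hc) q))]
          exact mul_le_mul_of_nonneg_left (Real.rpow_le_rpow (add_nonneg (hg0 x) hc)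
            (add_le_add_left (hgM x) c) hq0) hC0.le
        have hwi : ∀ (c : ℝ), 0 ≤ c → Integrable fun x =>
            -⟪gradient g x, gradient φ x⟫ + C0 * (g x + c) ^ q * φ x := fun c hc =>
          integrable_weak_integrand (measurable_gradient_real g).aestronglyMeasurable
            (((hg.continuous.measurable.add_const c).pow_const q).const_mul
              C0).aestronglyMeasurable (fun x => hg.norm_gradient_le x) (hF c hc) hφ hφc
        have h := hweak.integral_nonneg_of_eqOn hC0.le hq0 (by linarith) hg hg0 hgM
          (hug.mono ball_subset_closedBall) hφ hφc (hφη.trans hηρ) hφ0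
        have h0 := hwi 0 le_rfl
        simp only [add_zero] at h0
        simp only [hgrad]
        refine h.trans (integral_mono h0 (hwi δ hδ.le) fun x => ?_)
        have h1 : g x ^ q ≤ (g x + δ) ^ q := Real.rpow_le_rpow (hg0 x) (by linarith) hq0
        have h2 := hφ0 x
        dsimp only
        gcongr)
      (by
        have h1 : (∫ x in tsupport η, (g x + δ) ^ p) ^ (2 / (n : ℝ)) ≤ ε ^ (2 / (n : ℝ)) :=
          Real.rpow_le_rpow (integral_nonneg fun x => Real.rpow_nonneg (hpos x).le p) hJδ.le
            (by positivity)
        have h2 : ε ^ (2 / (n : ℝ)) = 1 / (2 * (β * C0 * Cs')) := by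
          rw [hε, ← Real.rpow_mul (by positivity)]
          rw [show (n : ℝ) / 2 * (2 / n) = 1 by field_simp, Real.rpow_one]
        rw [h2] at h1
        calc _ ≤ β * C0 * Cs' * (1 / (2 * (β * C0 * Cs'))) := by gcongr
          _ = 1 / 2 := by field_simp)
    have hA : ((4 / r).toNNReal : ℝ) ^ 2 = 16 / r ^ 2 := by
      rw [Real.coe_toNNReal _ (by positivity), div_pow]
      norm_num
    rw [hA] at key
    have hN2 : 0 < (n : ℝ) - 2 := by linarith
    refine le_trans ?_ (key.trans_eq (by ring))
    refine Real.rpow_le_rpow (setIntegral_nonneg measurableSet_ball fun x hx =>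
      Real.rpow_nonneg (hu0 x (ball_subset_ball (by linarith) hx)) _) ?_ (by positivity)
    have hwint : Integrable fun x =>
        |η x * (g x + δ) ^ (p / 2)| ^ ((2 * (n : ℝ)) / ((n : ℝ) - 2)) := by
      have hs : 0 < (2 * (n : ℝ)) / ((n : ℝ) - 2) := by positivity
      refine Continuous.integrable_of_hasCompactSupport ?_ ?_
      · exact (hη.continuous.mul (hgδ.continuous.rpow_const fun x =>
          Or.inl (hpos x).ne')).abs.rpow_const fun x => Or.inr hs.le
      · exact (hηc.mul_right (f' := fun x => (g x + δ) ^ (p / 2))).comp_left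
          (g := fun t : ℝ => |t| ^ ((2 * (n : ℝ)) / ((n : ℝ) - 2))) (by
            simp [Real.zero_rpow hs.ne'])
    refine le_trans ?_ (setIntegral_le_integral (s := ball 0 (r / 2)) hwint
      (Eventually.of_forall fun x => Real.rpow_nonneg (abs_nonneg _) _))
    refine integral_mono_of_nonneg (ae_restrict_of_forall_mem measurableSet_ball fun x hx =>
      Real.rpow_nonneg (hu0 x (ball_subset_ball (by linarith) hx)) _) hwint.integrableOn
      (ae_restrict_of_forall_mem measurableSet_ball fun x hx => ?_)
    have hux : u x = g x := hug (ball_subset_closedBall (ball_subset_ball (by linarith) hx))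
    dsimp only
    rw [hηone x hx, one_mul, abs_of_pos (Real.rpow_pos_of_pos (hpos x) _),
      ← Real.rpow_mul (hpos x).le, hux, show p / 2 * (2 * (n : ℝ) / ((n : ℝ) - 2)) =
        p * ((n : ℝ) / ((n : ℝ) - 2)) by ring]
    exact Real.rpow_le_rpow (hg0 x) (by linarith) (by positivity)
  refine (ge_of_tendsto (hlim.const_mul _) hest).trans ?_
  exact mul_le_mul_of_nonneg_left hJle (by positivity)
end
end

section
/- Let n ≥ 3, p > n/(n-2), q = (2p+n)/n, C_0 > 0. There exist ε > 0 and C > 0 such that: if r_1 > 0 and u is a nonnegative locally Lipschitz function on ℝ^n \ B_{r_1} with u ∈ L^p(ℝ^n \ B_{r_1}), satisfying Δu + C_0 u^q ≥ 0 weakly in ℝ^n \ B_{r_1}, ∫_{ℝ^n \ B_{r_1}} u^p dx < ε, and u(x) = O(|x|^{-n/p}) as |x| → ∞, then for all r ≥ r_1, ∫_{ℝ^n \ B_{2r}} u^p dx ≤ C ∫_{B_{2r} \ B_r} u^p dx. -/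
open MeasureTheory Metric Finset Filter Asymptotics
open scoped RealInnerProductSpace

noncomputable section

open scoped ContDiff

section Helpers

variable {n : ℕ}

local notation "𝔼" => EuclideanSpace ℝ (Fin n)

lemma gradient_apply (u : 𝔼 → ℝ) (x : 𝔼) (i : Fin n) : gradient u x i = pder u i x := by
  have h : ⟪gradient u x, EuclideanSpace.single i (1 : ℝ)⟫ = pder u i x := by
    simp [gradient, pder]
  rw [← h, EuclideanSpace.inner_single_right]
  simp

lemma inner_gradient (u φ : 𝔼 → ℝ) (x : 𝔼) :
    ⟪gradient u x, gradient φ x⟫ = ∑ i, pder u i x * pder φ i x := by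
  rw [PiLp.inner_apply]
  simp only [gradient_apply, RCLike.inner_apply, conj_trivial, mul_comm]

lemma norm_fderiv_sq (u : 𝔼 → ℝ) (x : 𝔼) : ‖fderiv ℝ u x‖ ^ 2 = ∑ i, pder u i x ^ 2 := by
  have h : ‖fderiv ℝ u x‖ = ‖gradient u x‖ := by simp [gradient]
  rw [h, EuclideanSpace.norm_sq_eq]
  simp [gradient_apply]

lemma contDiff_pder {u : 𝔼 → ℝ} (hu : ContDiff ℝ ∞ u) (i : Fin n) : ContDiff ℝ ∞ (pder u i) :=
  (hu.fderiv_right (by simp)).clm_apply contDiff_const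

lemma hasCompactSupport_pder {u : 𝔼 → ℝ} (hu : HasCompactSupport u) (i : Fin n) :
    HasCompactSupport (pder u i) :=
  hu.fderiv_apply ℝ _

/-- The Gagliardo–Nirenberg–Sobolev inequality for `C¹` functions, written with integrals. -/
lemma exists_sobolev_const (hn : 3 ≤ n) : ∃ S > (0 : ℝ), ∀ f : 𝔼 → ℝ, ContDiff ℝ 1 f →
    HasCompactSupport f →
    (∫ x, |f x| ^ (2 * (n : ℝ) / (n - 2))) ^ (((n : ℝ) - 2) / n)
      ≤ S * ∫ x, ∑ i, pder f i x ^ 2 := by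
  have hn' : (3 : ℝ) ≤ n := by exact_mod_cast hn
  set c := eLpNormLESNormFDerivOfEqInnerConst (volume : Measure 𝔼) (2 : NNReal) with hc
  refine ⟨c ^ 2 + 1, by positivity, fun f hf hfc => ?_⟩
  set s : ℝ := 2 * (n : ℝ) / (n - 2) with hs
  have hspos : 0 < s := by
    rw [hs]; apply div_pos <;> linarith
  have hsn : ((s.toNNReal : NNReal) : ℝ) = s := Real.coe_toNNReal s hspos.le
  have key := eLpNorm_le_eLpNorm_fderiv_of_eq_inner (volume : Measure 𝔼) hf hfc
    (p := 2) (p' := s.toNNReal) (by norm_num) (by simp; omega) (by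
      rw [hsn, hs]; simp
      have : (n : ℝ) - 2 ≠ 0 := by linarith
      field_simp)
  have m1 : MemLp f ((s.toNNReal : NNReal) : ENNReal) volume :=
    hf.continuous.memLp_of_hasCompactSupport hfc
  have m2 : MemLp (fderiv ℝ f) ((2 : NNReal) : ENNReal) volume :=
    (hf.continuous_fderiv one_ne_zero).memLp_of_hasCompactSupport (hfc.fderiv ℝ)
  rw [m1.eLpNorm_eq_integral_rpow_norm (by simpa using hspos) (by simp),
    m2.eLpNorm_eq_integral_rpow_norm (by simp) (by simp)] at key
  simp only [ENNReal.coe_toReal, hsn, NNReal.coe_ofNat, Real.rpow_ofNat, norm_fderiv_sq,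
    Real.norm_eq_abs] at key
  set I := ∫ x, |f x| ^ s
  set J := ∫ x, ∑ i, pder f i x ^ 2
  have hI : 0 ≤ I := integral_nonneg fun x => by positivity
  have hJ : 0 ≤ J := integral_nonneg fun x => by positivity
  rw [← ENNReal.ofReal_coe_nnreal, ← ENNReal.ofReal_mul (by positivity),
    ENNReal.ofReal_le_ofReal_iff (by positivity)] at key
  have e : I ^ (((n : ℝ) - 2) / n) = (I ^ s⁻¹) ^ 2 := by
    rw [← Real.rpow_natCast (I ^ s⁻¹), ← Real.rpow_mul hI, hs]
    congr 1
    have : (n : ℝ) - 2 ≠ 0 := by linarith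
    push_cast
    field_simp
  have e2 : (J ^ (2 : ℝ)⁻¹) ^ 2 = J := by
    rw [← Real.rpow_natCast, ← Real.rpow_mul hJ]; norm_num
  calc I ^ (((n : ℝ) - 2) / n) = (I ^ s⁻¹) ^ 2 := e
    _ ≤ (c * J ^ (2 : ℝ)⁻¹) ^ 2 := by gcongr; exact key
    _ = c ^ 2 * J := by rw [mul_pow, e2]
    _ ≤ (c ^ 2 + 1) * J := by gcongr; linarith

/-- Smoothness of a mollification. -/
lemma contDiff_mollify {g ρ : 𝔼 → ℝ} (hg : Continuous g) (hρ : ContDiff ℝ ∞ ρ)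
    (hρc : HasCompactSupport ρ) :
    ContDiff ℝ ∞ (convolution g ρ (ContinuousLinearMap.lsmul ℝ ℝ) volume) :=
  hρc.contDiff_convolution_right _ hg.locallyIntegrable hρ

lemma pder_mollify {g ρ : 𝔼 → ℝ} (hg : Continuous g) (hρ : ContDiff ℝ ∞ ρ)
    (hρc : HasCompactSupport ρ) (i : Fin n) :
    pder (convolution g ρ (ContinuousLinearMap.lsmul ℝ ℝ) volume) i
      = convolution g (pder ρ i) (ContinuousLinearMap.lsmul ℝ ℝ) volume := by
  ext x
  have h := hρc.hasFDerivAt_convolution_right (ContinuousLinearMap.lsmul ℝ ℝ)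
    (hg.locallyIntegrable (μ := volume)) (hρ.of_le (by simp)) x
  rw [pder, h.fderiv, convolution_precompR_apply _ hg.locallyIntegrable (hρc.fderiv ℝ)
    (hρ.continuous_fderiv (by simp))]
  rfl

lemma pder_comp_const_sub {ρ : 𝔼 → ℝ} (hρ : Differentiable ℝ ρ) (x y : 𝔼) (i : Fin n) :
    pder (fun y => ρ (x - y)) i y = -pder ρ i (x - y) := by
  have h := (hρ (x - y)).hasFDerivAt.comp y ((hasFDerivAt_id y).const_sub x)
  have h' : fderiv ℝ (fun y => ρ (x - y)) y = _ := h.fderiv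
  simp [pder, h']

/-- The Laplacian of the mollification of a Lipschitz function is the weak Laplacian tested
against the translated kernel. -/
lemma lap_mollify {v ρ : 𝔼 → ℝ} {K : NNReal} (hv : LipschitzWith K v) (hρ : ContDiff ℝ ∞ ρ)
    (hρc : HasCompactSupport ρ) (x : 𝔼) :
    Integrable (fun y => ⟪gradient v y, gradient (fun y => ρ (x - y)) y⟫) ∧
    lap (convolution v ρ (ContinuousLinearMap.lsmul ℝ ℝ) volume) x
      = -∫ y, ⟪gradient v y, gradient (fun y => ρ (x - y)) y⟫ := by
  have hcomp : ∀ i, HasCompactSupport (fun y => pder ρ i (x - y)) := fun i =>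
    (hasCompactSupport_pder hρc i).comp_homeomorph (Homeomorph.subLeft x)
  have hsm : ∀ i, ContDiff ℝ ∞ (fun y => pder ρ i (x - y)) := fun i =>
    (contDiff_pder hρ i).comp (contDiff_const.sub contDiff_id)
  have hint : ∀ i, Integrable (fun y => lineDeriv ℝ v y (EuclideanSpace.single i 1)
      * pder ρ i (x - y)) := fun i =>
    Integrable.mul_of_top_right
      ((hsm i).continuous.integrable_of_hasCompactSupport (hcomp i)) (hv.memLp_lineDeriv _)
  have hae : (fun y => ⟪gradient v y, gradient (fun y => ρ (x - y)) y⟫) =ᵐ[volume]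
      fun y => ∑ i, -(lineDeriv ℝ v y (EuclideanSpace.single i 1) * pder ρ i (x - y)) := by
    filter_upwards [hv.ae_differentiableAt] with y hy
    rw [inner_gradient]
    refine Finset.sum_congr rfl fun i _ => ?_
    rw [pder_comp_const_sub (hρ.differentiable (by simp)), hy.lineDeriv_eq_fderiv, pder]
    ring
  refine ⟨(integrable_congr hae).2
    (integrable_finsetSum _ fun i _ => Integrable.fun_neg (hint i)), ?_⟩
  rw [integral_congr_ae hae, integral_finsetSum _ fun i _ => Integrable.fun_neg (hint i),
    ← Finset.sum_neg_distrib, lap]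
  refine Finset.sum_congr rfl fun i _ => ?_
  rw [integral_neg, neg_neg]
  obtain ⟨D, hD⟩ := ContDiff.lipschitzWith_of_hasCompactSupport (hcomp i) (hsm i) (by simp)
  rw [hv.integral_lineDeriv_mul_eq hD (hcomp i), pder_mollify hv.continuous hρ hρc,
    pder_mollify hv.continuous (contDiff_pder hρ i) (hasCompactSupport_pder hρc i),
    convolution_def]
  refine integral_congr_ae (Eventually.of_forall fun y => ?_)
  have := pder_comp_const_sub ((contDiff_pder hρ i).differentiable (by simp)) x y i
  simp only [ContinuousLinearMap.lsmul_apply, smul_eq_mul]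
  rw [((hsm i).differentiable (by simp)).differentiableAt.lineDeriv_eq_fderiv, map_neg]
  rw [pder] at this
  rw [this]; ring

/-- The Caccioppoli (energy) inequality for a smooth positive `w` with `0 ≤ Δw + G` on the support
of the cutoff `η`, tested against `η² w^(β-1)`. -/
lemma caccioppoli {w η G : 𝔼 → ℝ} {β : ℝ} (hβ : 1 < β) (hw : ContDiff ℝ ∞ w)
    (hpos : ∀ x, 0 < w x) (hη : ContDiff ℝ ∞ η) (hηc : HasCompactSupport η) (hG : Continuous G)
    (hsub : ∀ x, η x ≠ 0 → 0 ≤ lap w x + G x) :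
    ∫ x, ∑ i, pder (fun y => η y * w y ^ (β / 2)) i x ^ 2
      ≤ β ^ 2 / (β - 1) * (∫ x, G x * (η x ^ 2 * w x ^ (β - 1)))
        + (2 + 2 * β ^ 2 / (β - 1) ^ 2) * ∫ x, w x ^ β * ∑ i, pder η i x ^ 2 := by
  have hβ' : 0 < β - 1 := by linarith
  have hpow : ∀ s : ℝ, ContDiff ℝ ∞ (fun x => w x ^ s) := fun s =>
    hw.rpow_const_of_ne fun x => (hpos x).ne'
  have hηd : Differentiable ℝ η := hη.differentiable (by simp)
  have hwd : Differentiable ℝ w := hw.differentiable (by simp)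
  set φ : 𝔼 → ℝ := fun x => η x ^ 2 * w x ^ (β - 1) with hφ
  have hφs : ContDiff ℝ ∞ φ := (hη.pow 2).mul (hpow _)
  have hφc : HasCompactSupport φ := by
    have : HasCompactSupport (fun x => η x * (η x * w x ^ (β - 1))) := hηc.mul_right
    simpa [hφ, pow_two, mul_assoc] using this
  have hfs : ContDiff ℝ ∞ (fun y => η y * w y ^ (β / 2)) := hη.mul (hpow _)
  have hfc : HasCompactSupport (fun y => η y * w y ^ (β / 2)) := hηc.mul_right
  have hpw : ∀ i, ContDiff ℝ ∞ (pder w i) := contDiff_pder hw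
  have hlapc : Continuous (lap w) :=
    continuous_finsetSum _ fun i _ => (contDiff_pder (hpw i) i).continuous
  have i1 : ∀ i, Integrable (fun x => φ x * pder (pder w i) i x) := fun i =>
    (hφs.continuous.mul (contDiff_pder (hpw i) i).continuous).integrable_of_hasCompactSupport
      hφc.mul_right
  have i2 : ∀ i, Integrable (fun x => pder φ i x * pder w i x) := fun i =>
    ((contDiff_pder hφs i).continuous.mul (hpw i).continuous).integrable_of_hasCompactSupport
      (hasCompactSupport_pder hφc i).mul_right
  have i3 : Integrable (fun x => φ x * G x) :=
    (hφs.continuous.mul hG).integrable_of_hasCompactSupport hφc.mul_right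
  have ibp : ∫ x, φ x * lap w x = -∫ x, ∑ i, pder φ i x * pder w i x := by
    simp only [lap, Finset.mul_sum]
    rw [integral_finsetSum _ fun i _ => i1 i, integral_finsetSum _ fun i _ => i2 i,
      ← Finset.sum_neg_distrib]
    refine Finset.sum_congr rfl fun i _ => ?_
    exact integral_mul_fderiv_eq_neg_fderiv_mul_of_integrable (i2 i) (i1 i)
      ((hφs.continuous.mul (hpw i).continuous).integrable_of_hasCompactSupport hφc.mul_right)
      (fun x _ => (hφs.differentiable (by simp)) x)
      (fun x _ => ((hpw i).differentiable (by simp)) x)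
  have i4 : Integrable (fun x => φ x * lap w x) :=
    (hφs.continuous.mul hlapc).integrable_of_hasCompactSupport hφc.mul_right
  have test : ∫ x, ∑ i, pder φ i x * pder w i x ≤ ∫ x, G x * φ x := by
    have h0 : 0 ≤ ∫ x, (φ x * lap w x + φ x * G x) := by
      refine integral_nonneg fun x => ?_
      rw [← mul_add]
      by_cases hx : η x = 0
      · simp [hφ, hx]
      · have := hsub x hx
        have := hpos x
        positivity
    rw [integral_add i4 i3, ibp] at h0
    simp only [mul_comm (G _)]
    linarith
  have pt : ∀ x, ∑ i, pder (fun y => η y * w y ^ (β / 2)) i x ^ 2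
      ≤ β ^ 2 / (β - 1) * (∑ i, pder φ i x * pder w i x)
        + (2 + 2 * β ^ 2 / (β - 1) ^ 2) * (w x ^ β * ∑ i, pder η i x ^ 2) := by
    intro x
    rw [Finset.mul_sum, Finset.mul_sum, Finset.mul_sum, ← Finset.sum_add_distrib]
    refine Finset.sum_le_sum fun i _ => ?_
    have hx := hpos x
    have d1 : pder (fun y => η y * w y ^ (β / 2)) i x
        = pder η i x * w x ^ (β / 2) + η x * (β / 2 * w x ^ (β / 2 - 1) * pder w i x) := by
      have h := (hηd x).hasFDerivAt.mul ((hwd x).hasFDerivAt.rpow_const (p := β / 2)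
        (Or.inl hx.ne'))
      have h' : fderiv ℝ (fun y => η y * w y ^ (β / 2)) x = _ := h.fderiv
      simp [pder, h']; ring
    have d2 : pder φ i x = 2 * η x * pder η i x * w x ^ (β - 1)
        + η x ^ 2 * ((β - 1) * w x ^ (β - 1 - 1) * pder w i x) := by
      have h := ((hηd x).hasFDerivAt.pow 2).mul ((hwd x).hasFDerivAt.rpow_const (p := β - 1)
        (Or.inl hx.ne'))
      have h' : fderiv ℝ φ x = _ := h.fderiv
      simp [pder, h']; ring
    set t := w x ^ (β / 2 - 1) with ht
    have e1 : w x ^ (β / 2) = t * w x := by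
      rw [ht, ← Real.rpow_add_one hx.ne']; ring_nf
    have e2 : w x ^ (β - 1 - 1) = t ^ 2 := by
      rw [ht, ← Real.rpow_natCast, ← Real.rpow_mul hx.le]; push_cast; ring_nf
    have e3 : w x ^ (β - 1) = t ^ 2 * w x := by
      rw [← e2, ← Real.rpow_add_one hx.ne']; ring_nf
    have e4 : w x ^ β = t ^ 2 * w x * w x := by
      rw [← e3, ← Real.rpow_add_one hx.ne']; ring_nf
    rw [d1, d2, e1, e2, e3, e4]
    set X := η x * t * pder w i x
    set Y := t * w x * pder η i x
    have l : pder η i x * (t * w x) + η x * (β / 2 * t * pder w i x) = Y + β / 2 * X := by ring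
    have r : β ^ 2 / (β - 1) * ((2 * η x * pder η i x * (t ^ 2 * w x)
        + η x ^ 2 * ((β - 1) * t ^ 2 * pder w i x)) * pder w i x)
        + (2 + 2 * β ^ 2 / (β - 1) ^ 2) * (t ^ 2 * w x * w x * pder η i x ^ 2)
        = β ^ 2 / (β - 1) * ((β - 1) * X ^ 2 + 2 * X * Y)
          + (2 + 2 * β ^ 2 / (β - 1) ^ 2) * Y ^ 2 := by ring
    rw [l, r]
    have id : β ^ 2 / (β - 1) * ((β - 1) * X ^ 2 + 2 * X * Y)
          + (2 + 2 * β ^ 2 / (β - 1) ^ 2) * Y ^ 2 - (Y + β / 2 * X) ^ 2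
        = (Y - β / 2 * X) ^ 2 + 2 * β ^ 2 * (X / 2 + Y / (β - 1)) ^ 2 := by
      field_simp; ring
    nlinarith [sq_nonneg (Y - β / 2 * X), mul_nonneg (sq_nonneg β)
      (sq_nonneg (X / 2 + Y / (β - 1)))]
  have hηp : HasCompactSupport (fun x => ∑ i, pder η i x ^ 2) := by
    have : (fun x => ∑ i, pder η i x ^ 2) = fun x => ‖fderiv ℝ η x‖ ^ 2 := by
      ext x; rw [norm_fderiv_sq]
    rw [this]
    exact (hηc.fderiv ℝ).comp_left (g := fun L => ‖L‖ ^ 2) (by simp)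
  have hfp : HasCompactSupport (fun x => ∑ i, pder (fun y => η y * w y ^ (β / 2)) i x ^ 2) := by
    have : (fun x => ∑ i, pder (fun y => η y * w y ^ (β / 2)) i x ^ 2)
        = fun x => ‖fderiv ℝ (fun y => η y * w y ^ (β / 2)) x‖ ^ 2 := by
      ext x; rw [norm_fderiv_sq]
    rw [this]
    exact (hfc.fderiv ℝ).comp_left (g := fun L => ‖L‖ ^ 2) (by simp)
  have j1 : Integrable (fun x => ∑ i, pder φ i x * pder w i x) :=
    integrable_finsetSum _ fun i _ => i2 i
  have j2 : Integrable (fun x => w x ^ β * ∑ i, pder η i x ^ 2) :=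
    ((hpow β).continuous.mul (continuous_finsetSum _ fun i _ =>
      (contDiff_pder hη i).continuous.pow 2)).integrable_of_hasCompactSupport hηp.mul_left
  have j0 : Integrable (fun x => ∑ i, pder (fun y => η y * w y ^ (β / 2)) i x ^ 2) :=
    (continuous_finsetSum _ fun i _ =>
      (contDiff_pder hfs i).continuous.pow 2).integrable_of_hasCompactSupport hfp
  calc _ ≤ ∫ x, (β ^ 2 / (β - 1) * (∑ i, pder φ i x * pder w i x)
        + (2 + 2 * β ^ 2 / (β - 1) ^ 2) * (w x ^ β * ∑ i, pder η i x ^ 2)) :=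
        integral_mono j0 ((j1.const_mul _).add (j2.const_mul _)) pt
    _ = β ^ 2 / (β - 1) * (∫ x, ∑ i, pder φ i x * pder w i x)
        + (2 + 2 * β ^ 2 / (β - 1) ^ 2) * ∫ x, w x ^ β * ∑ i, pder η i x ^ 2 := by
        rw [integral_add (j1.const_mul _) (j2.const_mul _), integral_const_mul,
          integral_const_mul]
    _ ≤ _ := by gcongr

/-- The pointwise differential inequality satisfied by the mollification of a weak subsolution. -/
lemma lap_mollify_nonneg {v F : 𝔼 → ℝ} {K : NNReal} (hv : LipschitzWith K v) (hF : Continuous F)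
    (ρ : ContDiffBump (0 : 𝔼)) (x : 𝔼)
    (hweak : ∀ φ : 𝔼 → ℝ, ContDiff ℝ ∞ φ → HasCompactSupport φ →
      tsupport φ ⊆ closedBall x ρ.rOut → (∀ y, 0 ≤ φ y) →
      0 ≤ ∫ y, (-⟪gradient v y, gradient φ y⟫ + F y * φ y)) :
    0 ≤ lap (convolution v (ρ.normed volume) (ContinuousLinearMap.lsmul ℝ ℝ) volume) x
      + convolution F (ρ.normed volume) (ContinuousLinearMap.lsmul ℝ ℝ) volume x := by
  have hρ : ContDiff ℝ ∞ (ρ.normed (volume : Measure 𝔼)) := ρ.contDiff_normed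
  have hρc : HasCompactSupport (ρ.normed (volume : Measure 𝔼)) := ρ.hasCompactSupport_normed
  have hφs : ContDiff ℝ ∞ (fun y => ρ.normed (volume : Measure 𝔼) (x - y)) :=
    hρ.comp (contDiff_const.sub contDiff_id)
  have hφc : HasCompactSupport (fun y => ρ.normed (volume : Measure 𝔼) (x - y)) :=
    hρc.comp_homeomorph (Homeomorph.subLeft x)
  obtain ⟨h1, h2⟩ := lap_mollify hv hρ hρc x
  have h3 := hweak (fun y => ρ.normed volume (x - y)) hφs hφc (by
    refine closure_minimal (fun y hy => ?_) isClosed_closedBall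
    have : x - y ∈ ball (0 : 𝔼) ρ.rOut := by
      rw [← ρ.support_normed_eq (μ := volume)]
      exact hy
    rw [mem_closedBall, dist_comm, dist_eq_norm]
    simpa using (mem_ball_zero_iff.1 this).le) (fun y => ρ.nonneg_normed _)
  have h4 : Integrable (fun y => F y * ρ.normed volume (x - y)) :=
    (hF.mul hφs.continuous).integrable_of_hasCompactSupport hφc.mul_left
  rw [integral_add h1.fun_neg h4, integral_neg] at h3
  rw [h2, convolution_def]
  exact h3

lemma mollify_swap (f : 𝔼 → ℝ) (ρ : 𝔼 → ℝ) :
    convolution f ρ (ContinuousLinearMap.lsmul ℝ ℝ) volume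
      = convolution ρ f (ContinuousLinearMap.lsmul ℝ ℝ) volume := by
  ext x
  rw [convolution_lsmul_swap, convolution_def]
  simp [mul_comm]

/-- The energy inequality combined with the Sobolev inequality, for a Lipschitz weak
subsolution. -/
lemma sobolev_energy (hn : 3 ≤ n) {S : ℝ} (hSpos : 0 < S)
    (hS : ∀ f : 𝔼 → ℝ, ContDiff ℝ 1 f → HasCompactSupport f →
      (∫ x, |f x| ^ (2 * (n : ℝ) / (n - 2))) ^ (((n : ℝ) - 2) / n)
        ≤ S * ∫ x, ∑ i, pder f i x ^ 2)
    {v η : 𝔼 → ℝ} {K : NNReal} {β q C0 δ : ℝ} (hv : LipschitzWith K v) (hv0 : ∀ x, 0 ≤ v x)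
    (hη : ContDiff ℝ ∞ η) (hηc : HasCompactSupport η) (hβ : 1 < β) (hq : 0 < q) (hC0 : 0 < C0)
    (hδ : 0 < δ)
    (hweak : ∀ x, η x ≠ 0 → ∀ φ : 𝔼 → ℝ, ContDiff ℝ ∞ φ → HasCompactSupport φ →
      tsupport φ ⊆ closedBall x δ → (∀ y, 0 ≤ φ y) →
      0 ≤ ∫ y, (-⟪gradient v y, gradient φ y⟫ + C0 * v y ^ q * φ y)) :
    (∫ x, |η x * v x ^ (β / 2)| ^ (2 * (n : ℝ) / (n - 2))) ^ (((n : ℝ) - 2) / n)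
      ≤ S * (β ^ 2 / (β - 1) * (∫ x, C0 * v x ^ q * (η x ^ 2 * v x ^ (β - 1)))
        + (2 + 2 * β ^ 2 / (β - 1) ^ 2) * ∫ x, v x ^ β * ∑ i, pder η i x ^ 2) := by
  have hn' : (3 : ℝ) ≤ n := by exact_mod_cast hn
  set s : ℝ := 2 * (n : ℝ) / (n - 2) with hs
  have hspos : 0 < s := by rw [hs]; apply div_pos <;> linarith
  have hβ1 : 0 < β - 1 := by linarith
  have hu0 : ∀ k : ℕ, (0 : ℝ) < 1 / ((k : ℝ) + 1) := fun k => by positivity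
  have hu1 : ∀ k : ℕ, (1 : ℝ) / ((k : ℝ) + 1) ≤ 1 := fun k => by
    rw [div_le_one (by positivity)]; linarith [(Nat.cast_nonneg k : (0 : ℝ) ≤ k)]
  have hulim : Tendsto (fun k : ℕ => (1 : ℝ) / ((k : ℝ) + 1)) atTop (nhds 0) :=
    tendsto_one_div_add_atTop_nhds_zero_nat
  let ρ : ℕ → ContDiffBump (0 : 𝔼) := fun k =>
    ⟨δ * (1 / ((k : ℝ) + 1)) / 2, δ * (1 / ((k : ℝ) + 1)), by have := hu0 k; positivity,
      by have := hu0 k; have : 0 < δ * (1 / ((k : ℝ) + 1)) := by positivity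
         linarith⟩
  have hρle : ∀ k, (ρ k).rOut ≤ δ := fun k => by
    have := hu1 k
    show δ * (1 / ((k : ℝ) + 1)) ≤ δ
    nlinarith
  have hρlim : Tendsto (fun k => (ρ k).rOut) atTop (nhds 0) := by
    simpa only [mul_zero] using hulim.const_mul δ
  set F : 𝔼 → ℝ := fun y => C0 * v y ^ q with hF
  have hvc : Continuous v := hv.continuous
  have hFc : Continuous F := continuous_const.mul (hvc.rpow_const fun _ => Or.inr hq.le)
  set V : ℕ → 𝔼 → ℝ := fun k =>
    convolution v ((ρ k).normed volume) (ContinuousLinearMap.lsmul ℝ ℝ) volume with hV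
  set G : ℕ → 𝔼 → ℝ := fun k =>
    convolution F ((ρ k).normed volume) (ContinuousLinearMap.lsmul ℝ ℝ) volume with hG
  set w : ℕ → 𝔼 → ℝ := fun k x => V k x + 1 / ((k : ℝ) + 1) with hw
  have hVs : ∀ k, ContDiff ℝ ∞ (V k) := fun k =>
    contDiff_mollify hvc (ρ k).contDiff_normed (ρ k).hasCompactSupport_normed
  have hGs : ∀ k, ContDiff ℝ ∞ (G k) := fun k =>
    contDiff_mollify hFc (ρ k).contDiff_normed (ρ k).hasCompactSupport_normed
  have hws : ∀ k, ContDiff ℝ ∞ (w k) := fun k => (hVs k).add contDiff_const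
  have hV0 : ∀ k x, 0 ≤ V k x := fun k x => by
    simp only [hV, convolution_def]
    exact integral_nonneg fun y => by
      simpa using mul_nonneg (hv0 y) ((ρ k).nonneg_normed (x - y))
  have hw0 : ∀ k x, 0 < w k x := fun k x => add_pos_of_nonneg_of_pos (hV0 k x) (hu0 k)
  have hlap : ∀ k x, lap (w k) x = lap (V k) x := fun k x => by
    have : ∀ i, pder (w k) i = pder (V k) i := fun i => by
      ext y; simp [pder, hw, fderiv_add_const]
    simp [lap, this]
  have hcac : ∀ k, (∫ x, |η x * w k x ^ (β / 2)| ^ s) ^ (((n : ℝ) - 2) / n)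
      ≤ S * (β ^ 2 / (β - 1) * (∫ x, G k x * (η x ^ 2 * w k x ^ (β - 1)))
        + (2 + 2 * β ^ 2 / (β - 1) ^ 2) * ∫ x, w k x ^ β * ∑ i, pder η i x ^ 2) := by
    intro k
    have hfs : ContDiff ℝ ∞ (fun y => η y * w k y ^ (β / 2)) :=
      hη.mul ((hws k).rpow_const_of_ne fun x => (hw0 k x).ne')
    refine (hS _ (hfs.of_le (by simp)) hηc.mul_right).trans ?_
    gcongr
    refine caccioppoli hβ (hws k) (hw0 k) hη hηc (hGs k).continuous fun x hx => ?_
    rw [hlap]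
    exact lap_mollify_nonneg hv hFc (ρ k) x fun φ h1 h2 h3 h4 =>
      hweak x hx φ h1 h2 (h3.trans (closedBall_subset_closedBall (hρle k))) h4
  have hwlim : ∀ x, Tendsto (fun k => w k x) atTop (nhds (v x)) := fun x => by
    have h := ContDiffBump.convolution_tendsto_right_of_continuous (μ := volume) hρlim hvc x
    have h' : Tendsto (fun k => V k x) atTop (nhds (v x)) :=
      h.congr fun k => by simp only [hV]; rw [mollify_swap]
    simpa only [add_zero] using h'.add hulim
  have hGlim : ∀ x, Tendsto (fun k => G k x) atTop (nhds (F x)) := fun x => by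
    have h := ContDiffBump.convolution_tendsto_right_of_continuous (μ := volume) hρlim hFc x
    exact h.congr fun k => by simp only [hG]; rw [mollify_swap]
  set M : 𝔼 → ℝ := fun x => v x + K * δ + 1 with hM
  have hMc : Continuous M := by fun_prop
  have hnear : ∀ k x, ∀ y ∈ ball x (ρ k).rOut, dist (v y) (v x) ≤ K * δ := fun k x y hy =>
    (hv.dist_le_mul y x).trans (by
      gcongr; exact (mem_ball.1 hy).le.trans (hρle k))
  have hM0 : ∀ x, 0 ≤ M x := fun x => by have := hv0 x; positivity
  have hwM : ∀ k x, w k x ≤ M x := fun k x => by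
    have h := ContDiffBump.dist_normed_convolution_le (μ := volume) (φ := ρ k) (x₀ := x)
      hvc.aestronglyMeasurable (hnear k x)
    rw [← mollify_swap, Real.dist_eq] at h
    have := (abs_le.1 h).2
    have := hu1 k
    simp only [hw, hM, hV]
    linarith
  have hGM : ∀ k x, |G k x| ≤ 2 * (C0 * M x ^ q) := fun k x => by
    have hFM : F x ≤ C0 * M x ^ q := by
      have := hv0 x
      have : v x ≤ M x := by simp only [hM]; nlinarith [mul_nonneg K.coe_nonneg hδ.le]
      simp only [hF]; gcongr
    have hF0 : ∀ y, 0 ≤ F y := fun y => mul_nonneg hC0.le (Real.rpow_nonneg (hv0 y) _)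
    have h := ContDiffBump.dist_normed_convolution_le (μ := volume) (φ := ρ k) (x₀ := x)
      (ε := C0 * M x ^ q) hFc.aestronglyMeasurable (fun y hy => by
        have h1 := hnear k x y hy
        rw [Real.dist_eq] at h1
        have h2 : F y ≤ C0 * M x ^ q := by
          have := hv0 y
          have : v y ≤ M x := by simp only [hM]; linarith [(abs_le.1 h1).2]
          simp only [hF]; gcongr
        rw [Real.dist_eq, abs_le]
        constructor <;> linarith [hF0 x, hF0 y])
    rw [← mollify_swap, Real.dist_eq] at h
    have h' := abs_le.1 h
    have h0 := hF0 x
    rw [abs_le]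
    simp only [hG]
    constructor <;> linarith
  have hgsq : Continuous (fun x => ∑ i, pder η i x ^ 2) :=
    continuous_finsetSum _ fun i _ => (contDiff_pder hη i).continuous.pow 2
  have hgsc : HasCompactSupport (fun x => ∑ i, pder η i x ^ 2) := by
    have : (fun x => ∑ i, pder η i x ^ 2) = fun x => ‖fderiv ℝ η x‖ ^ 2 := by
      ext x; rw [norm_fderiv_sq]
    rw [this]
    exact (hηc.fderiv ℝ).comp_left (g := fun L => ‖L‖ ^ 2) (by simp)
  have hwc : ∀ k (a : ℝ), Continuous fun x => w k x ^ a := fun k a =>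
    ((hws k).rpow_const_of_ne fun x => (hw0 k x).ne').continuous
  have hMpow : ∀ a : ℝ, 0 ≤ a → Continuous fun x => M x ^ a := fun a ha =>
    hMc.rpow_const fun _ => Or.inr ha
  have hη2 : HasCompactSupport (fun x => η x ^ 2) := by
    simp_rw [pow_two]
    exact hηc.mul_right (f' := η)
  have L1 : Tendsto (fun k => ∫ x, |η x * w k x ^ (β / 2)| ^ s) atTop
      (nhds (∫ x, |η x * v x ^ (β / 2)| ^ s)) := by
    refine tendsto_integral_of_dominated_convergence (fun x => |η x * M x ^ (β / 2)| ^ s)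
      (fun k => ?_) ?_ (fun k => Eventually.of_forall fun x => ?_)
      (Eventually.of_forall fun x => ?_)
    · exact ((hη.continuous.mul (hwc k _)).abs.rpow_const
        fun _ => Or.inr hspos.le).aestronglyMeasurable
    · refine ((hη.continuous.mul (hMpow _ (by positivity))).abs.rpow_const
        fun _ => Or.inr hspos.le).integrable_of_hasCompactSupport ?_
      exact (hηc.mul_right (f' := fun x => M x ^ (β / 2))).comp_left (g := fun t => |t| ^ s)
        (by simp [Real.zero_rpow hspos.ne'])
    · rw [Real.norm_of_nonneg (by positivity)]
      have := hwM k x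
      have := (hw0 k x).le
      rw [abs_mul, abs_mul, abs_of_nonneg (Real.rpow_nonneg (hw0 k x).le _),
        abs_of_nonneg (Real.rpow_nonneg (hM0 x) _)]
      gcongr
    · exact ((((hwlim x).rpow_const (Or.inr (by positivity))).const_mul _).abs).rpow_const
        (Or.inr hspos.le)
  have L2 : Tendsto (fun k => ∫ x, G k x * (η x ^ 2 * w k x ^ (β - 1))) atTop
      (nhds (∫ x, F x * (η x ^ 2 * v x ^ (β - 1)))) := by
    refine tendsto_integral_of_dominated_convergence
      (fun x => 2 * (C0 * M x ^ q) * (η x ^ 2 * M x ^ (β - 1)))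
      (fun k => ?_) ?_ (fun k => Eventually.of_forall fun x => ?_)
      (Eventually.of_forall fun x => ?_)
    · exact ((hGs k).continuous.mul ((hη.continuous.pow 2).mul (hwc k _))).aestronglyMeasurable
    · exact ((continuous_const.mul (continuous_const.mul (hMpow _ hq.le))).mul
        ((hη.continuous.pow 2).mul (hMpow _ hβ1.le))).integrable_of_hasCompactSupport
        (hη2.mul_right.mul_left)
    · have := hwM k x
      have := (hw0 k x).le
      have := hM0 x
      rw [norm_mul, Real.norm_eq_abs, Real.norm_of_nonneg (by positivity)]
      gcongr
      exact hGM k x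
    · exact (hGlim x).mul (((hwlim x).rpow_const (Or.inr hβ1.le)).const_mul _)
  have L3 : Tendsto (fun k => ∫ x, w k x ^ β * ∑ i, pder η i x ^ 2) atTop
      (nhds (∫ x, v x ^ β * ∑ i, pder η i x ^ 2)) := by
    refine tendsto_integral_of_dominated_convergence (fun x => M x ^ β * ∑ i, pder η i x ^ 2)
      (fun k => ?_) ?_ (fun k => Eventually.of_forall fun x => ?_)
      (Eventually.of_forall fun x => ?_)
    · exact ((hwc k _).mul hgsq).aestronglyMeasurable
    · exact ((hMpow _ (by linarith)).mul hgsq).integrable_of_hasCompactSupport hgsc.mul_left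
    · have := hwM k x
      have := (hw0 k x).le
      rw [Real.norm_of_nonneg (by positivity)]
      gcongr
    · exact ((hwlim x).rpow_const (Or.inr (by linarith))).mul_const _
  exact le_of_tendsto_of_tendsto' (L1.rpow_const (Or.inr (by
    apply div_nonneg <;> linarith))) (((L2.const_mul _).add (L3.const_mul _)).const_mul S) hcac

/-- Hölder's inequality for continuous nonnegative functions on a bounded measurable set. -/
lemma setIntegral_mul_le_of_continuous {f g : 𝔼 → ℝ} {A B : Set 𝔼} {P Q : ℝ}
    (hPQ : P.HolderConjugate Q) (hf : Continuous f) (hg : Continuous g) (hf0 : ∀ x, 0 ≤ f x)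
    (hg0 : ∀ x, 0 ≤ g x) (hB : IsCompact B) (hA : MeasurableSet A) (hAB : A ⊆ B) :
    ∫ x in A, f x * g x ≤ (∫ x in A, f x ^ P) ^ (1 / P) * (∫ x in A, g x ^ Q) ^ (1 / Q) := by
  have : IsFiniteMeasure (volume.restrict A) :=
    ⟨by simpa using (measure_mono hAB).trans_lt hB.measure_lt_top⟩
  have hmem : ∀ h : 𝔼 → ℝ, Continuous h → ∀ e, MemLp h e (volume.restrict A) := by
    intro h hh e
    obtain ⟨c, hc⟩ := hB.exists_bound_of_continuousOn hh.continuousOn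
    exact MemLp.of_bound hh.aestronglyMeasurable c
      ((ae_restrict_iff' hA).2 (Eventually.of_forall fun x hx => hc x (hAB hx)))
  exact integral_mul_le_Lp_mul_Lq_of_nonneg hPQ (Eventually.of_forall hf0)
    (Eventually.of_forall hg0) (hmem f hf _) (hmem g hg _)

/-- Smooth cutoffs at every scale `s`, with gradient of size `O(1/s)` supported in the annulus
`B_{2s} \ B_s`. -/
lemma exists_cutoff : ∃ M > (0 : ℝ), ∀ s > (0 : ℝ), ∃ g : 𝔼 → ℝ, ContDiff ℝ ∞ g ∧
    (∀ x, ‖x‖ ≤ 5 / 4 * s → g x = 1) ∧ (∀ x, 2 * s ≤ ‖x‖ → g x = 0) ∧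
    ∀ x, ‖fderiv ℝ g x‖ ^ 2 ≤ (ball 0 (2 * s) \ ball 0 s).indicator (fun _ => (M / s) ^ 2) x := by
  let b : ContDiffBump (0 : 𝔼) := ⟨5 / 4, 2, by norm_num, by norm_num⟩
  have hb : ContDiff ℝ ∞ b := b.contDiff
  obtain ⟨M, hM⟩ := (hb.continuous_fderiv (by simp)).bounded_above_of_compact_support
    (b.hasCompactSupport.fderiv ℝ)
  refine ⟨max M 1, by positivity, fun s hs => ⟨fun x => b (s⁻¹ • x), ?_, fun x hx => ?_, fun x hx => ?_, fun x => ?_⟩⟩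
  · exact hb.comp (contDiff_id.const_smul _)
  · refine b.one_of_mem_closedBall ?_
    rw [mem_closedBall_zero_iff, norm_smul, Real.norm_of_nonneg (by positivity), inv_mul_le_iff₀ hs]
    change _ ≤ s * (5 / 4)
    linarith
  · refine b.zero_of_le_dist ?_
    rw [dist_zero_right, norm_smul, Real.norm_of_nonneg (by positivity), le_inv_mul_iff₀ hs]
    change s * 2 ≤ _
    linarith
  · by_cases hx : x ∈ ball (0 : 𝔼) (2 * s) \ ball 0 s
    · rw [Set.indicator_of_mem hx]
      have h : HasFDerivAt (fun x => b (s⁻¹ • x))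
          ((fderiv ℝ b (s⁻¹ • x)).comp (s⁻¹ • ContinuousLinearMap.id ℝ 𝔼)) x :=
        ((hb.differentiable (by simp)) (s⁻¹ • x)).hasFDerivAt.comp x
          ((hasFDerivAt_id x).const_smul s⁻¹)
      rw [h.fderiv, ContinuousLinearMap.comp_smul, norm_smul, ContinuousLinearMap.comp_id,
        Real.norm_of_nonneg (by positivity), div_eq_inv_mul]
      gcongr
      exact (hM _).trans (le_max_left _ _)
    · rw [Set.indicator_of_notMem hx]
      suffices h : fderiv ℝ (fun x => b (s⁻¹ • x)) x = 0 by simp [h]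
      by_cases h1 : x ∈ ball (0 : 𝔼) s
      · refine IsLocalMax.fderiv_eq_zero (Eventually.of_forall fun y => ?_)
        have : b (s⁻¹ • x) = 1 := by
          refine b.one_of_mem_closedBall ?_
          rw [mem_closedBall_zero_iff, norm_smul, Real.norm_of_nonneg (by positivity),
            inv_mul_le_iff₀ hs]
          change _ ≤ s * (5 / 4)
          linarith [mem_ball_zero_iff.1 h1]
        simpa only [this] using b.le_one
      · have h2 : 2 * s ≤ ‖x‖ := by
          by_contra h2
          exact hx ⟨by simpa using h2, h1⟩
        refine IsLocalMin.fderiv_eq_zero (Eventually.of_forall fun y => ?_)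
        have : b (s⁻¹ • x) = 0 := by
          refine b.zero_of_le_dist ?_
          rw [dist_zero_right, norm_smul, Real.norm_of_nonneg (by positivity), le_inv_mul_iff₀ hs]
          change s * 2 ≤ _
          linarith
        simpa only [this] using b.nonneg

/-- On a compact annulus a locally Lipschitz weak subsolution agrees with a globally Lipschitz
nonnegative function, which satisfies the same weak inequality there. -/
lemma exists_lipschitz_model {r1 r ρ C0 q : ℝ} (hr : r1 ≤ r) {u : 𝔼 → ℝ}
    (hu0 : ∀ x ∈ (ball (0 : 𝔼) r1)ᶜ, 0 ≤ u x) (hul : LocallyLipschitzOn (ball (0 : 𝔼) r1)ᶜ u)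
    (hweak : IsWeakSupersol (ball 0 r1)ᶜ u (fun x => C0 * u x ^ q)) :
    ∃ (v : 𝔼 → ℝ) (K : NNReal), LipschitzWith K v ∧ (∀ x, 0 ≤ v x) ∧
      (∀ x, r ≤ ‖x‖ → ‖x‖ ≤ ρ → v x = u x) ∧
      ∀ φ : 𝔼 → ℝ, ContDiff ℝ ∞ φ → HasCompactSupport φ →
        tsupport φ ⊆ {x | r < ‖x‖ ∧ ‖x‖ < ρ} → (∀ y, 0 ≤ φ y) →
        0 ≤ ∫ y, (-⟪gradient v y, gradient φ y⟫ + C0 * v y ^ q * φ y) := by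
  set B : Set 𝔼 := closedBall 0 ρ \ ball 0 r
  have hB : IsCompact B := (isCompact_closedBall _ _).diff isOpen_ball
  have hBΩ : B ⊆ (ball (0 : 𝔼) r1)ᶜ := fun x hx h => hx.2 (ball_subset_ball hr h)
  obtain ⟨K, hK⟩ := (hul.mono hBΩ).exists_lipschitzOnWith_of_compact hB
  obtain ⟨g, hg, hgu⟩ := hK.extend_real
  have hmem : ∀ x : 𝔼, r ≤ ‖x‖ → ‖x‖ ≤ ρ → x ∈ B := fun x h1 h2 =>
    ⟨by simpa using h2, by simpa using h1⟩
  have heq : ∀ x : 𝔼, r ≤ ‖x‖ → ‖x‖ ≤ ρ → max (g x) 0 = u x := fun x h1 h2 => by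
    rw [← hgu (hmem x h1 h2), max_eq_left (hu0 x (hBΩ (hmem x h1 h2)))]
  refine ⟨fun x => max (g x) 0, K, hg.max_const 0, fun x => le_max_right _ _, heq,
    fun φ h1 h2 h3 h4 => ?_⟩
  have hUo : IsOpen {x : 𝔼 | r < ‖x‖ ∧ ‖x‖ < ρ} :=
    (isOpen_lt continuous_const continuous_norm).inter (isOpen_lt continuous_norm continuous_const)
  have hUΩ : {x : 𝔼 | r < ‖x‖ ∧ ‖x‖ < ρ} ⊆ (ball (0 : 𝔼) r1)ᶜ := fun x hx =>
    hBΩ (hmem x hx.1.le hx.2.le)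
  have h := hweak φ h1 h2 (h3.trans (interior_maximal hUΩ hUo)) h4
  have hout : ∀ y, y ∉ {x : 𝔼 | r < ‖x‖ ∧ ‖x‖ < ρ} → φ y = 0 ∧ gradient φ y = 0 := fun y hy => by
    have h5 : y ∉ tsupport φ := fun h6 => hy (h3 h6)
    refine ⟨image_eq_zero_of_notMem_tsupport h5, ?_⟩
    have h7 : fderiv ℝ φ y = 0 := image_eq_zero_of_notMem_tsupport
      (fun h6 => h5 (tsupport_fderiv_subset ℝ h6))
    simp [gradient, h7]
  have hpt : ∀ y, -⟪gradient u y, gradient φ y⟫ + C0 * u y ^ q * φ y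
      = -⟪gradient (fun x => max (g x) 0) y, gradient φ y⟫ + C0 * max (g y) 0 ^ q * φ y := by
    intro y
    by_cases hy : y ∈ {x : 𝔼 | r < ‖x‖ ∧ ‖x‖ < ρ}
    · have he : u =ᶠ[nhds y] fun x => max (g x) 0 := by
        filter_upwards [hUo.mem_nhds hy] with z hz
        exact (heq z hz.1.le hz.2.le).symm
      have hgr : gradient u y = gradient (fun x => max (g x) 0) y := by
        rw [gradient, gradient, he.fderiv_eq]
      rw [hgr, heq y hy.1.le hy.2.le]
    · obtain ⟨h5, h6⟩ := hout y hy
      simp [h5, h6]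
  simp only [hpt] at h
  rwa [setIntegral_eq_integral_of_forall_compl_eq_zero] at h
  intro y hy
  obtain ⟨h5, h6⟩ := hout y fun h => hy (hUΩ h)
  simp [h5, h6]

/-- Hölder's inequality on the annulus `B_{2s} \ B_s`, comparing `L^β` and `L^p` for
`β = p (n - 2) / n`. -/
lemma annulus_holder (hn : 3 ≤ n) {v : 𝔼 → ℝ} (hvc : Continuous v) (hv0 : ∀ x, 0 ≤ v x)
    {p β s : ℝ} (hβ : β = p * (((n : ℝ) - 2) / n)) (hβ0 : 0 ≤ β) (hs : 0 < s) :
    ∫ x in ball (0 : 𝔼) (2 * s) \ ball 0 s, v x ^ β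
      ≤ 4 * s ^ 2 * volume.real (ball (0 : 𝔼) 1) ^ (2 / (n : ℝ)) *
        (∫ x in ball (0 : 𝔼) (2 * s) \ ball 0 s, v x ^ p) ^ (((n : ℝ) - 2) / n) := by
  have hn' : (3 : ℝ) ≤ n := by exact_mod_cast hn
  have hn2 : (n : ℝ) - 2 ≠ 0 := by linarith
  have hPQ : ((n : ℝ) / 2).HolderConjugate ((n : ℝ) / (n - 2)) := by
    rw [Real.holderConjugate_iff]
    exact ⟨by linarith, by field_simp; ring⟩
  have h := setIntegral_mul_le_of_continuous (A := ball (0 : 𝔼) (2 * s) \ ball 0 s) hPQ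
    (continuous_const (y := (1 : ℝ))) (hvc.rpow_const fun _ => Or.inr hβ0)
    (fun _ => zero_le_one) (fun x => Real.rpow_nonneg (hv0 x) β)
    (isCompact_closedBall (0 : 𝔼) (2 * s)) (measurableSet_ball.diff measurableSet_ball)
    (Set.sdiff_subset.trans ball_subset_closedBall)
  have e : ∀ x, (v x ^ β) ^ ((n : ℝ) / (n - 2)) = v x ^ p := fun x => by
    rw [← Real.rpow_mul (hv0 x), hβ]; congr 1; field_simp
  simp only [one_mul, Real.one_rpow, e, integral_const, smul_eq_mul, mul_one, one_div_div] at h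
  refine h.trans ?_
  gcongr
  · exact Real.rpow_nonneg (integral_nonneg fun x => Real.rpow_nonneg (hv0 x) _) _
  have hvol : volume.real (ball (0 : 𝔼) (2 * s) \ ball 0 s)
      ≤ (2 * s) ^ n * volume.real (ball (0 : 𝔼) 1) := by
    have : Nontrivial 𝔼 := by
      have : Nontrivial (Fin n) := Fin.nontrivial_iff_two_le.2 (by omega)
      infer_instance
    refine (measureReal_mono Set.sdiff_subset measure_ball_lt_top.ne).trans ?_
    rw [measureReal_def, Measure.addHaar_ball _ _ (by positivity), ENNReal.toReal_mul,
      ENNReal.toReal_ofReal (by positivity), measureReal_def]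
    simp
  rw [measureReal_restrict_apply MeasurableSet.univ, Set.univ_inter]
  calc volume.real (ball (0 : 𝔼) (2 * s) \ ball 0 s) ^ (2 / (n : ℝ))
      ≤ ((2 * s) ^ n * volume.real (ball (0 : 𝔼) 1)) ^ (2 / (n : ℝ)) := by gcongr
    _ = 4 * s ^ 2 * volume.real (ball (0 : 𝔼) 1) ^ (2 / (n : ℝ)) := by
      rw [Real.mul_rpow (by positivity) (by positivity), ← Real.rpow_natCast,
        ← Real.rpow_mul (by positivity)]
      congr 1
      have : (n : ℝ) * (2 / n) = (2 : ℕ) := by field_simp; norm_num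
      rw [this, Real.rpow_natCast]; ring

/-- The estimate on a finite annulus: the `L^p` mass between `2r` and `5R/4` is controlled by that
of the two transition annuli at scales `r` and `R`. -/
lemma annulus_step (hn : 3 ≤ n) {p q C0 S M β ε : ℝ} (hSpos : 0 < S)
    (hS : ∀ f : 𝔼 → ℝ, ContDiff ℝ 1 f → HasCompactSupport f →
      (∫ x, |f x| ^ (2 * (n : ℝ) / (n - 2))) ^ (((n : ℝ) - 2) / n)
        ≤ S * ∫ x, ∑ i, pder f i x ^ 2)
    (hcut : ∀ s > (0 : ℝ), ∃ g : 𝔼 → ℝ, ContDiff ℝ ∞ g ∧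
      (∀ x, ‖x‖ ≤ 5 / 4 * s → g x = 1) ∧ (∀ x, 2 * s ≤ ‖x‖ → g x = 0) ∧
      ∀ x, ‖fderiv ℝ g x‖ ^ 2 ≤
        (ball 0 (2 * s) \ ball 0 s).indicator (fun _ => (M / s) ^ 2) x)
    (hp : 0 < p) (hq : q = (2 * p + n) / n) (hC0 : 0 < C0)
    (hβ : β = p * (((n : ℝ) - 2) / n)) (hβ1 : 1 < β)
    (hε : S * (β ^ 2 / (β - 1)) * (C0 * ε ^ (2 / (n : ℝ))) ≤ 1 / 2)
    {r1 r R : ℝ} (hr1 : 0 < r1) (hr : r1 ≤ r) (hR : 2 * r ≤ R) {u : 𝔼 → ℝ}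
    (hu0 : ∀ x ∈ (ball (0 : 𝔼) r1)ᶜ, 0 ≤ u x) (hul : LocallyLipschitzOn (ball (0 : 𝔼) r1)ᶜ u)
    (hint : IntegrableOn (fun x => u x ^ p) (ball (0 : 𝔼) r1)ᶜ)
    (hweak : IsWeakSupersol (ball 0 r1)ᶜ u (fun x => C0 * u x ^ q))
    (hsmall : ∫ x in (ball (0 : 𝔼) r1)ᶜ, u x ^ p < ε) :
    (∫ x in ball (0 : 𝔼) (5 / 4 * R) \ ball 0 (2 * r), u x ^ p) ^ (((n : ℝ) - 2) / n)
      ≤ 16 * S * (2 + 2 * β ^ 2 / (β - 1) ^ 2) * M ^ 2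
          * volume.real (ball (0 : 𝔼) 1) ^ (2 / (n : ℝ))
        * ((∫ x in ball (0 : 𝔼) (2 * r) \ ball 0 r, u x ^ p) ^ (((n : ℝ) - 2) / n)
          + (∫ x in ball (0 : 𝔼) (2 * R) \ ball 0 R, u x ^ p) ^ (((n : ℝ) - 2) / n)) := by
  have hn' : (3 : ℝ) ≤ n := by exact_mod_cast hn
  have hn2 : (n : ℝ) - 2 ≠ 0 := by linarith
  have hn2' : 0 < (n : ℝ) - 2 := by linarith
  have hr0 : 0 < r := by linarith
  have hR0 : 0 < R := by linarith
  have hβ0 : 0 < β - 1 := by linarith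
  have hqpos : 0 < q := by rw [hq]; positivity
  set a : ℝ := ((n : ℝ) - 2) / n with ha
  have ha0 : 0 < a := by positivity
  obtain ⟨v, K, hv, hv0, hvu, hvweak⟩ :=
    exists_lipschitz_model (ρ := 3 * R) hr hu0 hul hweak
  obtain ⟨g, hgs, hgone, hgzero, hgd⟩ := hcut r hr0
  obtain ⟨h, hhs, hhone, hhzero, hhd⟩ := hcut R hR0
  have hvc := hv.continuous
  set η : 𝔼 → ℝ := fun x => h x - g x with hηdef
  have hηs : ContDiff ℝ ∞ η := hhs.sub hgs
  have hηout : ∀ x, 2 * R ≤ ‖x‖ → η x = 0 := fun x hx => by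
    simp [hηdef, hhzero x hx, hgzero x (by linarith)]
  have hηin : ∀ x, ‖x‖ ≤ 5 / 4 * r → η x = 0 := fun x hx => by
    simp [hηdef, hgone x hx, hhone x (by linarith)]
  have hηc : HasCompactSupport η :=
    HasCompactSupport.intro (isCompact_closedBall (0 : 𝔼) (2 * R)) fun x hx => hηout x (by
      simp only [mem_closedBall_zero_iff, not_le] at hx; exact hx.le)
  have hηone : ∀ x, 2 * r ≤ ‖x‖ → ‖x‖ ≤ 5 / 4 * R → η x = 1 := fun x h1 h2 => by
    simp [hηdef, hhone x h2, hgzero x h1]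
  have hηsupp : ∀ x, η x ≠ 0 → 5 / 4 * r < ‖x‖ ∧ ‖x‖ < 2 * R := fun x hx =>
    ⟨not_le.1 fun h' => hx (hηin x h'), not_le.1 fun h' => hx (hηout x h')⟩
  have main := sobolev_energy hn hSpos hS (δ := r / 8) hv hv0 hηs hηc hβ1 hqpos hC0
    (by positivity) (fun x hx φ h1 h2 h3 h4 => hvweak φ h1 h2 (h3.trans fun y hy => by
      obtain ⟨h5, h6⟩ := hηsupp x hx
      have h7 := mem_closedBall.1 hy
      rw [dist_eq_norm] at h7
      have h8 := abs_le.1 (abs_norm_sub_norm_le y x)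
      constructor <;> linarith) h4)
  set A : Set 𝔼 := closedBall 0 (2 * R) \ ball 0 r
  have hAc : IsCompact A := (isCompact_closedBall _ _).diff isOpen_ball
  have hAm : MeasurableSet A := measurableSet_closedBall.diff measurableSet_ball
  have hAmem : ∀ x, η x ≠ 0 → x ∈ A := fun x hx => by
    obtain ⟨h5, h6⟩ := hηsupp x hx
    refine ⟨by simpa using h6.le, ?_⟩
    simp only [mem_ball_zero_iff, not_lt]
    linarith
  have hAu : ∀ x ∈ A, v x = u x := fun x hx => by
    have h1 : ‖x‖ ≤ 2 * R := by simpa using hx.1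
    have h2 : r ≤ ‖x‖ := by simpa using hx.2
    exact hvu x h2 (by linarith)
  have hpow : ∀ x, |η x * v x ^ (β / 2)| ^ (2 * (n : ℝ) / (n - 2))
      = (η x ^ 2 * v x ^ β) ^ ((n : ℝ) / (n - 2)) := fun x => by
    have e : η x ^ 2 * v x ^ β = |η x * v x ^ (β / 2)| ^ (2 : ℝ) := by
      rw [Real.rpow_two, sq_abs, mul_pow, ← Real.rpow_natCast (v x ^ (β / 2)),
        ← Real.rpow_mul (hv0 x)]
      congr 2; push_cast; ring
    rw [e, ← Real.rpow_mul (abs_nonneg _)]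
    congr 1; ring
  simp only [hpow] at main
  set I : ℝ := ∫ x, (η x ^ 2 * v x ^ β) ^ ((n : ℝ) / (n - 2)) with hI
  have hcont2 : Continuous fun x => η x ^ 2 * v x ^ β :=
    (hηs.continuous.pow 2).mul (hvc.rpow_const fun _ => Or.inr (by linarith))
  have hne : (n : ℝ) / (n - 2) ≠ 0 := by positivity
  have hIA : ∫ x in A, (η x ^ 2 * v x ^ β) ^ ((n : ℝ) / (n - 2)) = I :=
    setIntegral_eq_integral_of_forall_compl_eq_zero fun x hx => by
      have : η x = 0 := by by_contra h'; exact hx (hAmem x h')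
      simp [this, Real.zero_rpow hne]
  have hI0 : 0 ≤ I := integral_nonneg fun x => by have := hv0 x; positivity
  have hPQ : ((n : ℝ) / 2).HolderConjugate ((n : ℝ) / (n - 2)) := by
    rw [Real.holderConjugate_iff]
    exact ⟨by linarith, by field_simp; ring⟩
  have hreac : ∫ x, C0 * v x ^ q * (η x ^ 2 * v x ^ (β - 1))
      ≤ C0 * (ε ^ (2 / (n : ℝ)) * I ^ a) := by
    have e1 : ∀ x, C0 * v x ^ q * (η x ^ 2 * v x ^ (β - 1))
        = C0 * (v x ^ (2 * p / n) * (η x ^ 2 * v x ^ β)) := fun x => by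
      have e2 : v x ^ q * v x ^ (β - 1) = v x ^ (2 * p / n) * v x ^ β := by
        rw [← Real.rpow_add_of_nonneg (hv0 x) hqpos.le hβ0.le,
          ← Real.rpow_add_of_nonneg (hv0 x) (by positivity) (by linarith), hq]
        congr 1; field_simp; ring
      linear_combination C0 * η x ^ 2 * e2
    simp only [e1]
    rw [integral_const_mul]
    gcongr
    have e3 : ∫ x in A, v x ^ (2 * p / n) * (η x ^ 2 * v x ^ β)
        = ∫ x, v x ^ (2 * p / n) * (η x ^ 2 * v x ^ β) :=
      setIntegral_eq_integral_of_forall_compl_eq_zero fun x hx => by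
        have : η x = 0 := by by_contra h'; exact hx (hAmem x h')
        simp [this]
    rw [← e3]
    refine (setIntegral_mul_le_of_continuous hPQ
      (hvc.rpow_const fun _ => Or.inr (by positivity)) hcont2
      (fun x => Real.rpow_nonneg (hv0 x) _) (fun x => by have := hv0 x; positivity) hAc hAm
      subset_rfl).trans ?_
    rw [hIA, one_div_div, one_div_div]
    gcongr
    · exact integral_nonneg fun x => by have := hv0 x; positivity
    · have e4 : ∀ x, (v x ^ (2 * p / n)) ^ ((n : ℝ) / 2) = v x ^ p := fun x => by
        rw [← Real.rpow_mul (hv0 x)]; congr 1; field_simp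
      simp only [e4]
      rw [setIntegral_congr_fun (g := fun x => u x ^ p) hAm fun x hx => by
        simp only [hAu x hx]]
      refine le_trans (setIntegral_mono_set hint ?_ ?_) hsmall.le
      · exact (ae_restrict_iff' measurableSet_ball.compl).2
          (Eventually.of_forall fun x hx => Real.rpow_nonneg (hu0 x hx) _)
      · exact Eventually.of_forall fun x hx h' => hx.2 (ball_subset_ball hr h')
  have hann : ∀ s, r ≤ s → s ≤ R →
      ∫ x in ball (0 : 𝔼) (2 * s) \ ball 0 s, v x ^ p
        = ∫ x in ball (0 : 𝔼) (2 * s) \ ball 0 s, u x ^ p := fun s h1 h2 => by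
    refine setIntegral_congr_fun (measurableSet_ball.diff measurableSet_ball) fun x hx => ?_
    have h3 : ‖x‖ < 2 * s := by simpa using hx.1
    have h4 : s ≤ ‖x‖ := by simpa using hx.2
    simp only [hvu x (by linarith) (by linarith)]
  have hint_ann : ∀ s c : ℝ, Integrable
      ((ball (0 : 𝔼) (2 * s) \ ball 0 s).indicator fun x => v x ^ β * c) := fun s c =>
    (integrable_indicator_iff (measurableSet_ball.diff measurableSet_ball)).2
      ((((hvc.rpow_const fun _ => Or.inr (by linarith)).mul
        continuous_const).continuousOn.integrableOn_compact
        (isCompact_closedBall (0 : 𝔼) (2 * s))).mono_set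
        (Set.sdiff_subset.trans ball_subset_closedBall))
  have hgrad : ∫ x, v x ^ β * ∑ i, pder η i x ^ 2
      ≤ 8 * M ^ 2 * volume.real (ball (0 : 𝔼) 1) ^ (2 / (n : ℝ))
        * ((∫ x in ball (0 : 𝔼) (2 * r) \ ball 0 r, u x ^ p) ^ a
          + (∫ x in ball (0 : 𝔼) (2 * R) \ ball 0 R, u x ^ p) ^ a) := by
    have hb : ∀ x, v x ^ β * ∑ i, pder η i x ^ 2
        ≤ (ball (0 : 𝔼) (2 * r) \ ball 0 r).indicator (fun x => v x ^ β * (2 * (M / r) ^ 2)) x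
          + (ball (0 : 𝔼) (2 * R) \ ball 0 R).indicator
            (fun x => v x ^ β * (2 * (M / R) ^ 2)) x := fun x => by
      rw [← norm_fderiv_sq]
      have e1 : fderiv ℝ η x = fderiv ℝ h x - fderiv ℝ g x :=
        fderiv_fun_sub (hhs.differentiable (by simp) x) (hgs.differentiable (by simp) x)
      have e2 : ‖fderiv ℝ η x‖ ^ 2 ≤ 2 * ‖fderiv ℝ g x‖ ^ 2 + 2 * ‖fderiv ℝ h x‖ ^ 2 := by
        rw [e1]
        have := norm_sub_le (fderiv ℝ h x) (fderiv ℝ g x)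
        have := norm_nonneg (fderiv ℝ h x - fderiv ℝ g x)
        nlinarith [sq_nonneg (‖fderiv ℝ h x‖ - ‖fderiv ℝ g x‖)]
      have e3 : ∀ (s : Set 𝔼) (c : ℝ), s.indicator (fun x => v x ^ β * (2 * c)) x
          = v x ^ β * (2 * s.indicator (fun _ => c) x) := fun s c => by
        by_cases hx : x ∈ s <;> simp [hx]
      rw [e3, e3, ← mul_add]
      have := hgd x
      have := hhd x
      exact mul_le_mul_of_nonneg_left (by linarith) (Real.rpow_nonneg (hv0 x) _)
    have hscale : ∀ s, 0 < s → r ≤ s → s ≤ R →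
        ∫ x in ball (0 : 𝔼) (2 * s) \ ball 0 s, v x ^ β * (2 * (M / s) ^ 2)
        ≤ 8 * M ^ 2 * volume.real (ball (0 : 𝔼) 1) ^ (2 / (n : ℝ))
          * (∫ x in ball (0 : 𝔼) (2 * s) \ ball 0 s, u x ^ p) ^ a := fun s hs h1 h2 => by
      rw [integral_mul_const, ← hann s h1 h2]
      refine (mul_le_mul_of_nonneg_right (annulus_holder hn hvc hv0 hβ (by linarith) hs)
        (by positivity)).trans_eq ?_
      field_simp
      ring
    refine (integral_mono_of_nonneg (Eventually.of_forall fun x => ?_)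
      ((hint_ann r _).add (hint_ann R _)) (Eventually.of_forall hb)).trans ?_
    · exact mul_nonneg (Real.rpow_nonneg (hv0 x) _) (Finset.sum_nonneg fun i _ => sq_nonneg _)
    · rw [integral_add' (hint_ann r _) (hint_ann R _),
        integral_indicator (measurableSet_ball.diff measurableSet_ball),
        integral_indicator (measurableSet_ball.diff measurableSet_ball), mul_add]
      exact add_le_add (hscale r hr0 le_rfl (by linarith)) (hscale R hR0 (by linarith) le_rfl)
  have hlow : ∫ x in ball (0 : 𝔼) (5 / 4 * R) \ ball 0 (2 * r), u x ^ p ≤ I := by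
    have hIint : Integrable fun x => (η x ^ 2 * v x ^ β) ^ ((n : ℝ) / (n - 2)) := by
      refine (hcont2.rpow_const fun _ => Or.inr (by positivity)).integrable_of_hasCompactSupport
        (HasCompactSupport.intro hAc fun x hx => ?_)
      have : η x = 0 := by by_contra h'; exact hx (hAmem x h')
      simp [this, Real.zero_rpow hne]
    refine le_trans (le_of_eq ?_) (setIntegral_le_integral
      (s := ball (0 : 𝔼) (5 / 4 * R) \ ball 0 (2 * r)) hIint
      (Eventually.of_forall fun x => by have := hv0 x; positivity))
    refine setIntegral_congr_fun (measurableSet_ball.diff measurableSet_ball) fun x hx => ?_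
    have h3 : ‖x‖ < 5 / 4 * R := by simpa using hx.1
    have h4 : 2 * r ≤ ‖x‖ := by simpa using hx.2
    have h5 := hv0 x
    simp only [hηone x h4 h3.le, one_pow, one_mul]
    rw [← hvu x (by linarith) (by linarith), ← Real.rpow_mul h5, hβ, ha]
    congr 1; field_simp
  have hlow0 : 0 ≤ ∫ x in ball (0 : 𝔼) (5 / 4 * R) \ ball 0 (2 * r), u x ^ p :=
    setIntegral_nonneg (measurableSet_ball.diff measurableSet_ball) fun x hx =>
      Real.rpow_nonneg (hu0 x fun h' => hx.2 (ball_subset_ball (by linarith) h')) _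
  refine (Real.rpow_le_rpow hlow0 hlow ha0.le).trans ?_
  set T := (∫ x in ball (0 : 𝔼) (2 * r) \ ball 0 r, u x ^ p) ^ a
          + (∫ x in ball (0 : 𝔼) (2 * R) \ ball 0 R, u x ^ p) ^ a
  set W := volume.real (ball (0 : 𝔼) 1) ^ (2 / (n : ℝ))
  have f1 : S * (β ^ 2 / (β - 1) * (C0 * (ε ^ (2 / (n : ℝ)) * I ^ a))) ≤ 1 / 2 * I ^ a := by
    have := mul_le_mul_of_nonneg_right hε (Real.rpow_nonneg hI0 a)
    linarith
  have f2 : I ^ a ≤ S * (β ^ 2 / (β - 1) * (C0 * (ε ^ (2 / (n : ℝ)) * I ^ a))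
      + (2 + 2 * β ^ 2 / (β - 1) ^ 2) * (8 * M ^ 2 * W * T)) :=
    main.trans (by gcongr)
  linarith


/-- Letting the outer radius tend to infinity in an estimate of the type of `annulus_step`. -/
lemma rpow_exterior_le {f : 𝔼 → ℝ} {a D r1 r : ℝ} (ha : 0 < a) (hr0 : 0 < r) (hr : r1 ≤ r)
    (hint : IntegrableOn f (ball (0 : 𝔼) r1)ᶜ) (hf : ∀ x ∈ (ball (0 : 𝔼) r1)ᶜ, 0 ≤ f x)
    (h : ∀ R, 2 * r ≤ R → (∫ x in ball (0 : 𝔼) (5 / 4 * R) \ ball 0 (2 * r), f x) ^ a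
      ≤ D * ((∫ x in ball (0 : 𝔼) (2 * r) \ ball 0 r, f x) ^ a
          + (∫ x in ball (0 : 𝔼) (2 * R) \ ball 0 R, f x) ^ a)) :
    (∫ x in (ball (0 : 𝔼) (2 * r))ᶜ, f x) ^ a
      ≤ D * (∫ x in ball (0 : 𝔼) (2 * r) \ ball 0 r, f x) ^ a := by
  let R : ℕ → ℝ := fun N => 2 * r + N
  have hRmono : Monotone R := fun i j hij => by simpa [R] using hij
  have hR2 : ∀ N, 2 * r ≤ R N := fun N => by simp [R]
  have hsub : ∀ s, r ≤ s → (ball (0 : 𝔼) s)ᶜ ⊆ (ball (0 : 𝔼) r1)ᶜ := fun s hs =>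
    Set.compl_subset_compl.2 (ball_subset_ball (by linarith))
  have hlarge : ∀ x : 𝔼, ∃ N : ℕ, ‖x‖ < R N := fun x => by
    obtain ⟨N, hN⟩ := exists_nat_gt ‖x‖
    exact ⟨N, by simp only [R]; linarith⟩
  have hunion : ⋃ N, ball (0 : 𝔼) (5 / 4 * R N) \ ball 0 (2 * r) = (ball 0 (2 * r))ᶜ := by
    ext x
    simp only [Set.mem_iUnion, Set.mem_sdiff, mem_ball_zero_iff, Set.mem_compl_iff]
    refine ⟨fun ⟨_, hx⟩ => hx.2, fun hx => ?_⟩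
    obtain ⟨N, hN⟩ := hlarge x
    exact ⟨N, by linarith [hR2 N], hx⟩
  have hinter : ⋂ N, (ball (0 : 𝔼) (R N))ᶜ = ∅ := by
    ext x
    simpa using hlarge x
  have lim1 := tendsto_setIntegral_of_monotone (μ := volume) (f := f)
    (s := fun N => ball (0 : 𝔼) (5 / 4 * R N) \ ball 0 (2 * r))
    (fun N => measurableSet_ball.diff measurableSet_ball)
    (fun i j hij => Set.sdiff_subset_sdiff_left
      (ball_subset_ball (by linarith [hRmono hij])))
    (by rw [hunion]; exact hint.mono_set (hsub _ (by linarith)))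
  rw [hunion] at lim1
  have lim2 := tendsto_setIntegral_of_antitone (μ := volume) (f := f)
    (s := fun N => (ball (0 : 𝔼) (R N))ᶜ) (fun N => measurableSet_ball.compl)
    (fun i j hij => Set.compl_subset_compl.2 (ball_subset_ball (hRmono hij)))
    ⟨0, hint.mono_set (hsub _ (by linarith [hR2 0]))⟩
  rw [hinter, setIntegral_empty] at lim2
  have lim3 : Tendsto (fun N => ∫ x in ball (0 : 𝔼) (2 * R N) \ ball 0 (R N), f x)
      atTop (nhds 0) := by
    refine squeeze_zero (fun N => ?_) (fun N => ?_) lim2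
    · exact setIntegral_nonneg (measurableSet_ball.diff measurableSet_ball) fun x hx =>
        hf x (hsub _ (by linarith [hR2 N]) hx.2)
    · refine setIntegral_mono_set (hint.mono_set (hsub _ (by linarith [hR2 N]))) ?_
        (Eventually.of_forall fun x hx => hx.2)
      exact (ae_restrict_iff' measurableSet_ball.compl).2
        (Eventually.of_forall fun x hx => hf x (hsub _ (by linarith [hR2 N]) hx))
  have lim4 := lim3.rpow_const (p := a) (Or.inr ha.le)
  rw [Real.zero_rpow ha.ne'] at lim4
  have := le_of_tendsto_of_tendsto' (lim1.rpow_const (p := a) (Or.inr ha.le))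
    ((lim4.const_add _).const_mul D) fun N => h (R N) (hR2 N)
  simpa using this

end Helpers

/-- **Annulus domination of the exterior `Lᵖ` norm.** Let `p > n/(n-2)`,
`q = (2p+n)/n`, `C₀ > 0`. There exist `ε, C > 0` such that if `u ≥ 0` is locally
Lipschitz on `ℝⁿ \ B_{r₁}`, `u ∈ Lᵖ`, `Δu + C₀ u^q ≥ 0` weakly, `∫ uᵖ < ε`, and
`u(x) = O(|x|^{-n/p})` at infinity, then for all `r ≥ r₁`,
`∫_{ℝⁿ \ B_{2r}} uᵖ ≤ C ∫_{B_{2r} \ B_r} uᵖ`. -/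
theorem exterior_annulus_bound
    (n : ℕ) (hn : 3 ≤ n) (p q C0 : ℝ) (hp : (n : ℝ) / ((n : ℝ) - 2) < p)
    (hq : q = (2 * p + n) / n) (hC0 : 0 < C0) :
    ∃ ε > (0 : ℝ), ∃ C > (0 : ℝ), ∀ r1 : ℝ, 0 < r1 →
      ∀ u : EuclideanSpace ℝ (Fin n) → ℝ,
      (∀ x ∈ (ball (0 : EuclideanSpace ℝ (Fin n)) r1)ᶜ, 0 ≤ u x) →
      LocallyLipschitzOn (ball (0 : EuclideanSpace ℝ (Fin n)) r1)ᶜ u →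
      IntegrableOn (fun x => u x ^ p) (ball (0 : EuclideanSpace ℝ (Fin n)) r1)ᶜ →
      IsWeakSupersol (ball 0 r1)ᶜ u (fun x => C0 * u x ^ q) →
      (∫ x in (ball (0 : EuclideanSpace ℝ (Fin n)) r1)ᶜ, u x ^ p) < ε →
      (∃ C4 R4 : ℝ, ∀ x : EuclideanSpace ℝ (Fin n), R4 ≤ ‖x‖ →
        u x ≤ C4 * ‖x‖ ^ (-(n : ℝ) / p)) →
      ∀ r : ℝ, r1 ≤ r →
        (∫ x in (ball (0 : EuclideanSpace ℝ (Fin n)) (2 * r))ᶜ, u x ^ p)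
          ≤ C * ∫ x in ball (0 : EuclideanSpace ℝ (Fin n)) (2 * r) \
              ball (0 : EuclideanSpace ℝ (Fin n)) r, u x ^ p := by
  have hn' : (3 : ℝ) ≤ n := by exact_mod_cast hn
  have hn2 : 0 < (n : ℝ) - 2 := by linarith
  have hp0 : 0 < p := lt_trans (by positivity) hp
  obtain ⟨S, hSpos, hS⟩ := exists_sobolev_const hn
  obtain ⟨M, hM, hcut⟩ := exists_cutoff (n := n)
  set a : ℝ := ((n : ℝ) - 2) / n with ha
  have ha0 : 0 < a := by positivity
  set β : ℝ := p * a with hβ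
  have hβ1 : 1 < β := by
    rw [div_lt_iff₀ hn2] at hp
    rw [hβ, ha, mul_div_assoc', lt_div_iff₀ (by positivity)]
    linarith
  have hβ0 : 0 < β - 1 := by linarith
  set A : ℝ := β ^ 2 / (β - 1)
  have hA : 0 < A := by positivity
  set ε : ℝ := (1 / (2 * S * A * C0)) ^ ((n : ℝ) / 2) with hεdef
  have hε : S * A * (C0 * ε ^ (2 / (n : ℝ))) ≤ 1 / 2 := by
    have h1 : (n : ℝ) / 2 * (2 / n) = 1 := by field_simp
    rw [hεdef, ← Real.rpow_mul (by positivity), h1, Real.rpow_one]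
    exact le_of_eq (by field_simp)
  set D : ℝ := 16 * S * (2 + 2 * β ^ 2 / (β - 1) ^ 2) * M ^ 2
          * volume.real (ball (0 : EuclideanSpace ℝ (Fin n)) 1) ^ (2 / (n : ℝ)) with hD
  have hD0 : 0 ≤ D := by positivity
  refine ⟨ε, by positivity, (D + 1) ^ (1 / a), by positivity, ?_⟩
  intro r1 hr1 u hu0 hul hint hweak hsmall _ r hr
  have hr0 : 0 < r := by linarith
  have hup0 : ∀ x ∈ (ball (0 : EuclideanSpace ℝ (Fin n)) r1)ᶜ, 0 ≤ u x ^ p := fun x hx =>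
    Real.rpow_nonneg (hu0 x hx) _
  have hnn : ∀ s, r1 ≤ s → ∀ E : Set (EuclideanSpace ℝ (Fin n)), MeasurableSet E →
      E ⊆ (ball 0 s)ᶜ → 0 ≤ ∫ x in E, u x ^ p := fun s hs E hE hE' =>
    setIntegral_nonneg hE fun x hx => hup0 x fun h => hE' hx (ball_subset_ball hs h)
  have h0 := hnn (2 * r) (by linarith) _ measurableSet_ball.compl subset_rfl
  have h1 := hnn r hr (ball 0 (2 * r) \ ball 0 r) (measurableSet_ball.diff measurableSet_ball)
    fun x hx => hx.2
  have key := rpow_exterior_le ha0 hr0 hr hint hup0 fun R hR =>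
    annulus_step hn hSpos hS hcut hp0 hq hC0 hβ hβ1 hε hr1 hr hR hu0 hul hint hweak hsmall
  have e : ∀ t : ℝ, 0 ≤ t → (t ^ a) ^ (1 / a) = t := fun t ht => by
    rw [← Real.rpow_mul ht, mul_one_div_cancel ha0.ne', Real.rpow_one]
  rw [← e _ h0, ← e _ h1, ← Real.mul_rpow (by positivity) (by positivity)]
  refine Real.rpow_le_rpow (by positivity) (key.trans ?_) (by positivity)
  gcongr
  linarith
end
end
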